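/- Lower bound in the ballot theorem in the extreme regime: fix δ > 0. There exists ε > 0 such that for all N ∈ ℕ and all x, y > 0 with xy = δN, the random walk bridge from x to y on ⟦0,N⟧ satisfies P(X(k) ≥ 0 for k = 1,...,N-1) ≥ ε. -/

import Mathlib

open MeasureTheory Real
open scoped ENNReal

noncomputable section

/-- The full trajectory over `⟦0, n+1⟧` of a bridge with boundary values `u, v`
and interior values `q`. -/
def pathOf (u v : ℝ) (n : ℕ) (q : Fin n → ℝ) : ℕ → ℝ :=
  fun t => if h : 1 ≤ t ∧ t ≤ n then q ⟨t - 1, by omega⟩ else if t = 0 then u else v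

/-- Unnormalized density of a random walk bridge on `⟦0, n+1⟧` from `u` to `v`,
with increment Hamiltonian `H`: the product of `exp(-H(increment))` over all steps. -/
def bridgeDensity (H : ℝ → ℝ) (u v : ℝ) (n : ℕ) (q : Fin n → ℝ) : ℝ :=
  ∏ j ∈ Finset.range (n + 1),
    Real.exp (-(H (pathOf u v n q (j + 1) - pathOf u v n q j)))

/-- The (unnormalized) law of the interior points of a random walk bridge. -/
def bridgeMeasure (H : ℝ → ℝ) (u v : ℝ) (n : ℕ) : Measure (Fin n → ℝ) :=
  volume.withDensity fun q => ENNReal.ofReal (bridgeDensity H u v n q)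

open scoped Classical in
/-- The (unnormalized) law of a random walk bridge on `⟦0, n+1⟧` from `u` to `v`
constrained to stay above the floor in the interior, with area tilt
`exp(-c · Σ_j (X(j) - floor(j)))`. -/
def tiltedMeasure (H : ℝ → ℝ) (u v : ℝ) (n : ℕ) (c : ℝ) (floor : ℕ → ℝ) :
    Measure (Fin n → ℝ) :=
  volume.withDensity fun q =>
    ENNReal.ofReal (bridgeDensity H u v n q
      * Real.exp (-(c * ∑ j ∈ Finset.range (n + 1), (pathOf u v n q j - floor j)))
      * if ∀ t, 1 ≤ t → t ≤ n → floor t ≤ pathOf u v n q t then 1 else 0)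

/-- Probability of an event under the normalization of a finite measure. -/
def probOf {α : Type*} [MeasurableSpace α] (μ : Measure α) (E : Set α) : ℝ≥0∞ :=
  μ E / μ Set.univ

/-- The normalized (probability) version of a measure. -/
def normalizeMeasure {α : Type*} [MeasurableSpace α] (μ : Measure α) : Measure α :=
  (μ Set.univ)⁻¹ • μ

/-- Fluctuation scale `H_λ = λ^{-1/3} N^{1/3}`. -/
def Hlam (lam N : ℝ) : ℝ := lam ^ (-(1 : ℝ) / 3) * N ^ ((1 : ℝ) / 3)

/-- Assumptions on the random walk Hamiltonian: convexity (log-concavity of the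
increment density), zero mean, positive finite variance, and finite exponential
moments near zero. -/
structure RWAssumptions (H : ℝ → ℝ) : Prop where
  convex : ConvexOn ℝ Set.univ H
  integrable_exp : Integrable fun x : ℝ => Real.exp (-(H x))
  norm_pos : 0 < ∫ x : ℝ, Real.exp (-(H x))
  mean_zero : (∫ x : ℝ, x * Real.exp (-(H x))) = 0
  integrable_sq : Integrable fun x : ℝ => x ^ 2 * Real.exp (-(H x))
  var_pos : 0 < ∫ x : ℝ, x ^ 2 * Real.exp (-(H x))
  mgf : ∃ t₀ > 0, ∀ t : ℝ, |t| ≤ t₀ →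
    Integrable fun x : ℝ => Real.exp (t * x) * Real.exp (-(H x))

end

/-- A convex function with integrable `exp (-H)` takes values at least `H 0 + 1` on the positive axis. -/
lemma exists_pos_large {H : ℝ → ℝ} (hHexp : Integrable fun x : ℝ => Real.exp (-(H x))) :
    ∃ z > 0, H 0 + 1 ≤ H z := by
  by_contra! h
  have h1 : IntegrableOn (fun _ : ℝ => Real.exp (-(H 0 + 1))) (Set.Ioi 0) := by
    refine Integrable.mono' hHexp.integrableOn (by fun_prop) ?_
    refine (ae_restrict_iff' measurableSet_Ioi).2 (Filter.Eventually.of_forall fun z hz => ?_)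
    rw [Real.norm_eq_abs, abs_of_pos (Real.exp_pos _)]
    exact Real.exp_le_exp.2 (by linarith [h z hz])
  rw [integrableOn_const_iff] at h1
  simp at h1

lemma exists_growth_right {H : ℝ → ℝ} (hc : ConvexOn ℝ Set.univ H)
    (hHexp : Integrable fun x : ℝ => Real.exp (-(H x))) :
    ∃ z > 0, ∀ r, z ≤ r → H 0 + r / z ≤ H r := by
  obtain ⟨z, hz, hHz⟩ := exists_pos_large hHexp
  refine ⟨z, hz, fun r hr => ?_⟩
  have hr0 : 0 < r := hz.trans_le hr
  have h := hc.2 (Set.mem_univ (0 : ℝ)) (Set.mem_univ r)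
    (by rw [sub_nonneg, div_le_one hr0]; exact hr : 0 ≤ 1 - z / r)
    (by positivity : 0 ≤ z / r) (by ring)
  simp only [smul_eq_mul, mul_zero, zero_add] at h
  rw [div_mul_cancel₀ _ hr0.ne'] at h
  have h2 : 1 ≤ z / r * (H r - H 0) := by nlinarith
  have h3 : r / z * 1 ≤ r / z * (z / r * (H r - H 0)) := by gcongr
  have h4 : r / z * (z / r * (H r - H 0)) = H r - H 0 := by field_simp
  linarith

lemma exists_growth {H : ℝ → ℝ} (hc : ConvexOn ℝ Set.univ H)
    (hHexp : Integrable fun x : ℝ => Real.exp (-(H x))) :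
    ∃ α > 0, ∃ β, ∀ r, α * |r| - β ≤ H r := by
  obtain ⟨z, hz, h1⟩ := exists_growth_right hc hHexp
  have hc' : ConvexOn ℝ Set.univ (fun x => H (-x)) := by
    refine ⟨convex_univ, fun a _ b _ s t hs ht hst => ?_⟩
    have := hc.2 (Set.mem_univ (-a)) (Set.mem_univ (-b)) hs ht hst
    convert this using 2
    simp only [smul_eq_mul]; ring
  obtain ⟨w, hw, h2⟩ := exists_growth_right hc' hHexp.comp_neg
  obtain ⟨m, -, hm⟩ := (isCompact_Icc (a := -w) (b := z)).exists_isMinOn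
    (Set.nonempty_Icc.2 (by linarith))
    ((hc.continuousOn isOpen_univ).mono (Set.subset_univ _))
  refine ⟨min (1 / z) (1 / w), by positivity, |H 0| + |H m| + (z + w) * min (1 / z) (1 / w),
    fun r => ?_⟩
  have hα : 0 < min (1 / z) (1 / w) := by positivity
  rcases le_or_gt z r with h | h
  · have := h1 r h
    rw [abs_of_nonneg (hz.le.trans h)]
    have h3 : min (1 / z) (1 / w) * r ≤ 1 / z * r := by
      gcongr
      · exact hz.le.trans h
      · exact min_le_left _ _
    have h4 : 1 / z * r = r / z := by ring
    nlinarith [neg_abs_le (H 0), abs_nonneg (H m)]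
  rcases le_or_gt r (-w) with h' | h'
  · have := h2 (-r) (by linarith)
    simp only [neg_neg, neg_zero] at this
    have hr : r ≤ 0 := by linarith
    rw [abs_of_nonpos hr]
    have h3 : min (1 / z) (1 / w) * -r ≤ 1 / w * -r := by
      gcongr
      · linarith
      · exact min_le_right _ _
    have h4 : 1 / w * -r = -r / w := by ring
    nlinarith [neg_abs_le (H 0), abs_nonneg (H m)]
  · have h3 : H m ≤ H r := hm ⟨h'.le, h.le⟩
    have h4 : |r| ≤ z + w := abs_le.2 ⟨by linarith, by linarith⟩
    nlinarith [neg_abs_le (H m), abs_nonneg (H 0)]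

lemma integral_id_mul_le_of_antitone {f : ℝ → ℝ} {L : ℝ} (hL : 0 ≤ L)
    (hf : AntitoneOn f (Set.Icc 0 L)) (hc : Continuous f) :
    ∫ u in (0 : ℝ)..L, u * f u ≤ L / 2 * ∫ u in (0 : ℝ)..L, f u := by
  have h0 : ∫ u in (0 : ℝ)..L, (u - L / 2) * f (L / 2) = 0 := by
    rw [intervalIntegral.integral_mul_const, intervalIntegral.integral_sub (by simp) (by simp)]
    simp only [integral_id, intervalIntegral.integral_const, smul_eq_mul]
    ring_nf
  have h1 : ∫ u in (0 : ℝ)..L, (u - L / 2) * f u ≤ ∫ u in (0 : ℝ)..L, (u - L / 2) * f (L / 2) := by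
    refine intervalIntegral.integral_mono_on hL ?_ ?_ fun u hu => ?_
    · exact (by fun_prop : Continuous fun u => (u - L / 2) * f u).intervalIntegrable _ _
    · exact (by fun_prop : Continuous fun u => (u - L / 2) * f (L / 2)).intervalIntegrable _ _
    · have hm : L / 2 ∈ Set.Icc 0 L := ⟨by linarith, by linarith⟩
      rcases le_total u (L / 2) with h | h
      · nlinarith [hf hu hm h]
      · nlinarith [hf hm hu h]
  have h2 : ∫ u in (0 : ℝ)..L, (u - L / 2) * f u
      = (∫ u in (0 : ℝ)..L, u * f u) - L / 2 * ∫ u in (0 : ℝ)..L, f u := by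
    rw [← intervalIntegral.integral_const_mul, ← intervalIntegral.integral_sub]
    · congr 1; ext u; ring
    · exact (by fun_prop : Continuous fun u => u * f u).intervalIntegrable _ _
    · exact (by fun_prop : Continuous fun u => L / 2 * f u).intervalIntegrable _ _
  linarith

lemma exp_neg_five_le : Real.exp (-5) ≤ 1 / 100 := by
  have h : (2.7 : ℝ) ^ 5 ≤ Real.exp 1 ^ 5 := by
    have := Real.exp_one_gt_d9
    gcongr; linarith
  rw [Real.exp_neg, inv_le_comm₀ (by positivity) (by norm_num)]
  rw [Real.exp_one_pow] at h
  norm_num at h ⊢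
  linarith

/-- Second moment of a half-line density `exp (-φ)` with `φ` convex, nonnegative, `φ 0 = 0`. -/
lemma second_moment_Ioi_le {φ : ℝ → ℝ} (hc : ConvexOn ℝ Set.univ φ) (h0 : φ 0 = 0)
    (hpos : ∀ u, 0 ≤ φ u) {L : ℝ} (hL : 0 < L) (hφL : 5 ≤ φ L)
    (hi0 : Integrable fun u => Real.exp (-φ u))
    (hi2 : Integrable fun u => u ^ 2 * Real.exp (-φ u)) :
    ∫ u in Set.Ioi (0 : ℝ), u ^ 2 * Real.exp (-φ u)
      ≤ 27 / 50 * L ^ 2 * ∫ u in Set.Ioi (0 : ℝ), Real.exp (-φ u) := by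
  have hcont : Continuous φ := continuousOn_univ.1 (hc.continuousOn isOpen_univ)
  have hscale : ∀ r s : ℝ, 0 ≤ r → r ≤ s → s * φ r ≤ r * φ s := by
    intro r s hr hrs
    rcases hr.eq_or_lt with rfl | hr'
    · simp [h0]
    have hs : 0 < s := hr'.trans_le hrs
    have h := hc.2 (Set.mem_univ (0 : ℝ)) (Set.mem_univ s)
      (by rw [sub_nonneg, div_le_one hs]; exact hrs : 0 ≤ 1 - r / s)
      (by positivity : 0 ≤ r / s) (by ring)
    simp only [smul_eq_mul, mul_zero, zero_add, h0] at h
    rw [div_mul_cancel₀ _ hs.ne'] at h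
    calc s * φ r ≤ s * (r / s * φ s) := by gcongr
      _ = r * φ s := by field_simp
  have hsup : ∀ s, 0 ≤ s → φ s + 5 ≤ φ (s + L) := by
    intro s hs
    have h1 := hscale s (s + L) hs (by linarith)
    have h2 := hscale L (s + L) hL.le (by linarith)
    have h3 : (s + L) * (φ s + φ L) ≤ (s + L) * φ (s + L) := by nlinarith
    have := le_of_mul_le_mul_left h3 (by linarith)
    linarith
  have hmono : ∀ r s : ℝ, 0 ≤ r → r ≤ s → φ r ≤ φ s := by
    intro r s hr hrs
    rcases hr.eq_or_lt with rfl | hr'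
    · rw [h0]; exact hpos s
    have h1 := hscale r s hr hrs
    have h2 : r * φ s ≤ s * φ s := by gcongr; exact hpos s
    exact le_of_mul_le_mul_left (h1.trans h2) (hr'.trans_le hrs)
  set I0 := ∫ u in Set.Ioi (0 : ℝ), Real.exp (-φ u) with hI0
  set I2 := ∫ u in Set.Ioi (0 : ℝ), u ^ 2 * Real.exp (-φ u) with hI2
  have hsplit : I2 = (∫ u in (0 : ℝ)..L, u ^ 2 * Real.exp (-φ u))
      + ∫ u in Set.Ioi L, u ^ 2 * Real.exp (-φ u) :=
    (intervalIntegral.integral_interval_add_Ioi hi2.integrableOn hi2.integrableOn).symm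
  have hsplit0 : I0 = (∫ u in (0 : ℝ)..L, Real.exp (-φ u))
      + ∫ u in Set.Ioi L, Real.exp (-φ u) :=
    (intervalIntegral.integral_interval_add_Ioi hi0.integrableOn hi0.integrableOn).symm
  have hnn0 : 0 ≤ ∫ u in Set.Ioi L, Real.exp (-φ u) :=
    integral_nonneg fun u => (Real.exp_pos _).le
  have hA : ∫ u in (0 : ℝ)..L, u ^ 2 * Real.exp (-φ u) ≤ L ^ 2 / 2 * I0 := by
    have h1 : ∫ u in (0 : ℝ)..L, u ^ 2 * Real.exp (-φ u)
        ≤ ∫ u in (0 : ℝ)..L, L * (u * Real.exp (-φ u)) := by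
      refine intervalIntegral.integral_mono_on hL.le ?_ ?_ fun u hu => ?_
      · exact (by fun_prop : Continuous fun u => u ^ 2 * Real.exp (-φ u)).intervalIntegrable _ _
      · exact (by fun_prop : Continuous fun u => L * (u * Real.exp (-φ u))).intervalIntegrable _ _
      · rw [← mul_assoc]
        gcongr
        nlinarith [hu.1, hu.2]
    have h2 := integral_id_mul_le_of_antitone (f := fun u => Real.exp (-φ u)) hL.le
      (fun r hr s _ hrs => Real.exp_le_exp.2 (neg_le_neg (hmono r s hr.1 hrs))) (by fun_prop)
    rw [intervalIntegral.integral_const_mul] at h1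
    calc _ ≤ _ := h1
      _ ≤ L * (L / 2 * ∫ u in (0 : ℝ)..L, Real.exp (-φ u)) := by gcongr
      _ ≤ L * (L / 2 * I0) := by gcongr; linarith
      _ = _ := by ring
  have hB : ∫ u in Set.Ioi L, u ^ 2 * Real.exp (-φ u) ≤ 1 / 100 * (2 * L ^ 2 * I0 + 2 * I2) := by
    have h1 : ∫ u in Set.Ioi L, u ^ 2 * Real.exp (-φ u)
        = ∫ s in Set.Ioi (0 : ℝ), (s + L) ^ 2 * Real.exp (-φ (s + L)) := by
      have := (measurePreserving_add_right (volume : Measure ℝ) L).setIntegral_preimage_emb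
        (measurableEmbedding_addRight L) (fun u => u ^ 2 * Real.exp (-φ u)) (Set.Ioi L)
      simpa using this.symm
    rw [h1]
    have h2 : ∫ s in Set.Ioi (0 : ℝ), (s + L) ^ 2 * Real.exp (-φ (s + L))
        ≤ ∫ s in Set.Ioi (0 : ℝ),
          1 / 100 * (2 * L ^ 2 * Real.exp (-φ s) + 2 * (s ^ 2 * Real.exp (-φ s))) := by
      refine setIntegral_mono_on ?_ ?_ measurableSet_Ioi fun s hs => ?_
      · exact (hi2.comp_add_right L).integrableOn
      · exact (((hi0.const_mul _).add (hi2.const_mul _)).const_mul _).integrableOn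
      · have h3 : Real.exp (-φ (s + L)) ≤ Real.exp (-5) * Real.exp (-φ s) := by
          rw [← Real.exp_add]
          exact Real.exp_le_exp.2 (by linarith [hsup s (le_of_lt hs)])
        have h4 := exp_neg_five_le
        have h5 := Real.exp_pos (-φ s)
        calc (s + L) ^ 2 * Real.exp (-φ (s + L))
            ≤ (2 * L ^ 2 + 2 * s ^ 2) * (1 / 100 * Real.exp (-φ s)) := by
              refine mul_le_mul (by nlinarith [sq_nonneg (s - L)]) ?_ (Real.exp_pos _).le
                (by positivity)
              exact h3.trans (by gcongr)
          _ = _ := by ring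
    refine h2.trans_eq ?_
    rw [integral_const_mul, integral_add (hi0.const_mul _).integrableOn
      (hi2.const_mul _).integrableOn, integral_const_mul, integral_const_mul]
  have hI0nn : 0 ≤ I0 := integral_nonneg fun u => (Real.exp_pos _).le
  nlinarith [mul_nonneg (sq_nonneg L) hI0nn]

lemma second_moment_even_le {φ : ℝ → ℝ} (hc : ConvexOn ℝ Set.univ φ) (h0 : φ 0 = 0)
    (heven : ∀ u, φ (-u) = φ u) {L : ℝ} (hL : 0 < L) (hφL : 5 ≤ φ L)
    (hi0 : Integrable fun u => Real.exp (-φ u))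
    (hi2 : Integrable fun u => u ^ 2 * Real.exp (-φ u)) :
    ∫ u, u ^ 2 * Real.exp (-φ u) ≤ 27 / 50 * L ^ 2 * ∫ u, Real.exp (-φ u) := by
  have hpos : ∀ u, 0 ≤ φ u := by
    intro u
    have h := hc.2 (Set.mem_univ (-u)) (Set.mem_univ u)
      (by norm_num : (0 : ℝ) ≤ 1 / 2) (by norm_num : (0 : ℝ) ≤ 1 / 2) (by norm_num)
    simp only [smul_eq_mul, heven] at h
    have : (1 / 2 : ℝ) * -u + 1 / 2 * u = 0 := by ring
    rw [this, h0] at h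
    linarith
  have habs : ∀ u, φ |u| = φ u := by
    intro u
    rcases abs_choice u with h | h <;> rw [h]
    exact heven u
  have h1 : ∫ u, u ^ 2 * Real.exp (-φ u)
      = 2 * ∫ u in Set.Ioi (0 : ℝ), u ^ 2 * Real.exp (-φ u) := by
    rw [← integral_comp_abs (f := fun u => u ^ 2 * Real.exp (-φ u))]
    simp [habs]
  have h2 : ∫ u, Real.exp (-φ u) = 2 * ∫ u in Set.Ioi (0 : ℝ), Real.exp (-φ u) := by
    rw [← integral_comp_abs (f := fun u => Real.exp (-φ u))]
    simp [habs]
  have := second_moment_Ioi_le hc h0 hpos hL hφL hi0 hi2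
  rw [h1, h2]
  linarith

lemma convex_three_point {H : ℝ → ℝ} (hc : ConvexOn ℝ Set.univ H) {c K : ℝ} (hcn : 0 ≤ c)
    (hK : 0 < K) : 2 * H c + H K ≤ H (2 * c + K) + 2 * H 0 := by
  have hs : 0 < 2 * c + K := by linarith
  have key : ∀ r, 0 ≤ r → r ≤ 2 * c + K →
      (2 * c + K) * H r ≤ r * H (2 * c + K) + (2 * c + K - r) * H 0 := by
    intro r hr hrs
    have h := hc.2 (Set.mem_univ (0 : ℝ)) (Set.mem_univ (2 * c + K))
      (by rw [sub_nonneg, div_le_one hs]; exact hrs : 0 ≤ 1 - r / (2 * c + K))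
      (by positivity : 0 ≤ r / (2 * c + K)) (by ring)
    simp only [smul_eq_mul, mul_zero, zero_add] at h
    rw [div_mul_cancel₀ _ hs.ne'] at h
    calc (2 * c + K) * H r
        ≤ (2 * c + K) * ((1 - r / (2 * c + K)) * H 0 + r / (2 * c + K) * H (2 * c + K)) := by
          gcongr
      _ = _ := by field_simp; ring
  have h1 := key c hcn (by linarith)
  have h2 := key K hK.le (by linarith)
  have : (2 * c + K) * (2 * H c + H K) ≤ (2 * c + K) * (H (2 * c + K) + 2 * H 0) := by nlinarith
  exact le_of_mul_le_mul_left this hs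

lemma integrable_comp_abs_of_integrableOn_Ioi {f : ℝ → ℝ} (hf : IntegrableOn f (Set.Ioi 0)) :
    Integrable fun u => f |u| := by
  have h1 : IntegrableOn (fun u => f |u|) (Set.Ioi 0) :=
    hf.congr_fun (fun u hu => by rw [abs_of_pos hu]) measurableSet_Ioi
  have h2 : IntegrableOn (fun u => f |u|) (Set.Iic 0) := by
    rw [← (Measure.measurePreserving_neg (volume : Measure ℝ)).integrableOn_comp_preimage
      (Homeomorph.neg ℝ).measurableEmbedding]
    simpa [Function.comp_def, integrableOn_Ici_iff_integrableOn_Ioi] using h1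
  rw [← integrableOn_univ, ← Set.Iic_union_Ioi (a := (0 : ℝ))]
  exact h2.union h1

lemma integrable_sq_mul_exp_neg_abs {a : ℝ} (ha : 0 < a) :
    Integrable fun u : ℝ => u ^ 2 * Real.exp (-(a * |u|)) := by
  have h : IntegrableOn (fun u : ℝ => u ^ 2 * Real.exp (-(a * u))) (Set.Ioi 0) := by
    have := integrableOn_rpow_mul_exp_neg_mul_rpow (s := 2) (p := 1) (b := a)
      (by norm_num) (by norm_num) ha
    simpa using this
  have := integrable_comp_abs_of_integrableOn_Ioi h
  simpa using this

lemma integrable_exp_neg_abs {a : ℝ} (ha : 0 < a) :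
    Integrable fun u : ℝ => Real.exp (-(a * |u|)) := by
  have h : IntegrableOn (fun u : ℝ => Real.exp (-(a * u))) (Set.Ioi 0) := by
    have := integrableOn_exp_mul_Ioi (a := -a) (by linarith) 0
    simpa using this
  have := integrable_comp_abs_of_integrableOn_Ioi h
  simpa using this

/-- Given the sum `2 * c` of two increments, the variance of their half-difference grows at most like
`(3 / 4) c ^ 2`. -/
lemma exists_pair_second_moment_le {H : ℝ → ℝ} (hc : ConvexOn ℝ Set.univ H)
    (hHexp : Integrable fun x : ℝ => Real.exp (-(H x))) :
    ∃ C, 0 ≤ C ∧ ∀ c : ℝ, ∫⁻ u, ENNReal.ofReal (u ^ 2 * Real.exp (-(H (c + u) + H (c - u))))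
      ≤ ∫⁻ u, ENNReal.ofReal ((C + 3 / 4 * c ^ 2) * Real.exp (-(H (c + u) + H (c - u)))) := by
  obtain ⟨α, hα, β, hgrow⟩ := exists_growth hc hHexp
  obtain ⟨K, hK, hK5⟩ : ∃ K > 0, 5 ≤ H K + H (-K) - 2 * H 0 := by
    refine ⟨(5 + 2 * |H 0| + 2 * |β|) / (2 * α), by positivity, ?_⟩
    set K := (5 + 2 * |H 0| + 2 * |β|) / (2 * α) with hK
    have h1 := hgrow K
    have h2 := hgrow (-K)
    have hKpos : 0 < K := by positivity
    rw [abs_neg] at h2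
    rw [abs_of_pos hKpos] at h1 h2
    have h3 : 2 * α * K = 5 + 2 * |H 0| + 2 * |β| := by rw [hK]; field_simp
    linarith [le_abs_self (H 0), le_abs_self β]
  refine ⟨4 * K ^ 2, by positivity, fun c => ?_⟩
  set φ : ℝ → ℝ := fun u => H (c + u) + H (c - u) - 2 * H c with hφ
  have hφc : ConvexOn ℝ Set.univ φ := by
    refine ⟨convex_univ, fun a _ b _ s t hs ht hst => ?_⟩
    have h1 := hc.2 (Set.mem_univ (c + a)) (Set.mem_univ (c + b)) hs ht hst
    have h2 := hc.2 (Set.mem_univ (c - a)) (Set.mem_univ (c - b)) hs ht hst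
    simp only [smul_eq_mul] at h1 h2
    have e1 : s * (c + a) + t * (c + b) = c + (s * a + t * b) := by
      linear_combination c * hst
    have e2 : s * (c - a) + t * (c - b) = c - (s * a + t * b) := by
      linear_combination c * hst
    rw [e1] at h1
    rw [e2] at h2
    simp only [hφ, smul_eq_mul]
    have : s * (2 * H c) + t * (2 * H c) = 2 * H c := by linear_combination 2 * H c * hst
    linarith
  have hcont : Continuous φ := continuousOn_univ.1 (hφc.continuousOn isOpen_univ)
  have hφL : 5 ≤ φ (|c| + K) := by
    rcases le_total 0 c with h | h
    · have := convex_three_point hc h hK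
      simp only [hφ, abs_of_nonneg h]
      rw [show c + (c + K) = 2 * c + K by ring, show c - (c + K) = -K by ring]
      linarith
    · have hc' : ConvexOn ℝ Set.univ (fun x => H (-x)) := by
        refine ⟨convex_univ, fun a _ b _ s t hs ht hst => ?_⟩
        have := hc.2 (Set.mem_univ (-a)) (Set.mem_univ (-b)) hs ht hst
        convert this using 2
        simp only [smul_eq_mul]; ring
      have := convex_three_point hc' (neg_nonneg.2 h) hK
      simp only [neg_neg, neg_zero] at this
      simp only [hφ, abs_of_nonpos h]
      rw [show c + (-c + K) = K by ring, show c - (-c + K) = -(2 * -c + K) by ring]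
      linarith
  have hlow : ∀ u, 2 * α * |u| - (2 * β + 2 * H c) ≤ φ u := by
    intro u
    have h1 := hgrow (c + u)
    have h2 := hgrow (c - u)
    have h3 : 2 * |u| ≤ |c + u| + |c - u| := by
      have := abs_sub (c + u) (c - u)
      rw [show c + u - (c - u) = 2 * u by ring, abs_mul, abs_two] at this
      exact this
    simp only [hφ]
    nlinarith
  have hexp : ∀ u, Real.exp (-φ u)
      ≤ Real.exp (2 * β + 2 * H c) * Real.exp (-(2 * α * |u|)) := by
    intro u
    rw [← Real.exp_add]
    exact Real.exp_le_exp.2 (by linarith [hlow u])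
  have hi0 : Integrable fun u => Real.exp (-φ u) := by
    refine Integrable.mono' ((integrable_exp_neg_abs (a := 2 * α) (by positivity)).const_mul
      (Real.exp (2 * β + 2 * H c))) (by fun_prop) (Filter.Eventually.of_forall fun u => ?_)
    rw [Real.norm_eq_abs, abs_of_pos (Real.exp_pos _)]
    exact hexp u
  have hi2 : Integrable fun u => u ^ 2 * Real.exp (-φ u) := by
    refine Integrable.mono' ((integrable_sq_mul_exp_neg_abs (a := 2 * α) (by positivity)).const_mul
      (Real.exp (2 * β + 2 * H c))) (by fun_prop) (Filter.Eventually.of_forall fun u => ?_)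
    rw [Real.norm_eq_abs, abs_of_nonneg (by positivity)]
    calc u ^ 2 * Real.exp (-φ u)
        ≤ u ^ 2 * (Real.exp (2 * β + 2 * H c) * Real.exp (-(2 * α * |u|))) := by
          gcongr; exact hexp u
      _ = _ := by ring
  have hmain := second_moment_even_le hφc (by simp [hφ]; ring)
    (fun u => by simp only [hφ]; rw [sub_neg_eq_add, ← sub_eq_add_neg]; ring)
    (by positivity : 0 < |c| + K) hφL hi0 hi2
  have hI0nn : 0 ≤ ∫ u, Real.exp (-φ u) := integral_nonneg fun u => (Real.exp_pos _).le
  have hmain' : ∫ u, u ^ 2 * Real.exp (-φ u)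
      ≤ (4 * K ^ 2 + 3 / 4 * c ^ 2) * ∫ u, Real.exp (-φ u) := by
    refine hmain.trans (mul_le_mul_of_nonneg_right ?_ hI0nn)
    nlinarith [sq_nonneg (|c| - 3 * K), sq_abs c]
  have hfac : ∀ u, Real.exp (-(H (c + u) + H (c - u))) = Real.exp (-(2 * H c)) * Real.exp (-φ u) := by
    intro u
    rw [← Real.exp_add]
    congr 1
    simp only [hφ]; ring
  rw [← ofReal_integral_eq_lintegral_ofReal, ← ofReal_integral_eq_lintegral_ofReal]
  · apply ENNReal.ofReal_le_ofReal
    simp only [hfac]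
    rw [integral_const_mul, integral_const_mul]
    have e : ∀ u : ℝ, u ^ 2 * (Real.exp (-(2 * H c)) * Real.exp (-φ u))
      = Real.exp (-(2 * H c)) * (u ^ 2 * Real.exp (-φ u)) := fun u => by ring
    simp only [e]
    rw [integral_const_mul]
    have := mul_le_mul_of_nonneg_left hmain' (Real.exp_pos (-(2 * H c))).le
    linarith
  · simp only [hfac]
    exact (hi0.const_mul _).const_mul _
  · exact Filter.Eventually.of_forall fun u => by positivity
  · simp only [hfac]
    convert hi2.const_mul (Real.exp (-(2 * H c))) using 2
    ring
  · exact Filter.Eventually.of_forall fun u => by positivity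

lemma ENNReal.add_le_add_of_mul_le_mul {p q a b : ℝ≥0∞} (hp : p ≤ a) (hq : q ≤ a)
    (h : p * q ≤ a * b) : p + q ≤ a + b := by
  rcases eq_or_ne a ∞ with rfl | ha
  · simp
  rcases eq_or_ne b ∞ with rfl | hb
  · simp
  have hp' := ne_top_of_le_ne_top ha hp
  have hq' := ne_top_of_le_ne_top ha hq
  lift a to NNReal using ha
  lift b to NNReal using hb
  lift p to NNReal using hp'
  lift q to NNReal using hq'
  norm_cast at *
  rcases eq_or_ne a 0 with rfl | ha0
  · simp_all
  have ha1 : (0 : ℝ) < a := by positivity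
  rw [← NNReal.coe_le_coe] at *
  push_cast at *
  have : (a : ℝ) * (p + q) ≤ a * (a + b) := by nlinarith
  exact le_of_mul_le_mul_left this ha1

/-- One-dimensional continuous four functions theorem. -/
lemma lintegral_four_functions {f₁ f₂ f₃ f₄ : ℝ → ℝ≥0∞} (h₁ : Measurable f₁) (h₂ : Measurable f₂)
    (h₃ : Measurable f₃) (h₄ : Measurable f₄)
    (h : ∀ a b, f₁ a * f₂ b ≤ f₃ (a ⊔ b) * f₄ (a ⊓ b)) :
    (∫⁻ a, f₁ a) * ∫⁻ b, f₂ b ≤ (∫⁻ a, f₃ a) * ∫⁻ b, f₄ b := by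
  have key : ∀ a b, f₁ a * f₂ b + f₁ b * f₂ a ≤ f₃ a * f₄ b + f₃ b * f₄ a := by
    have aux : ∀ a b, b ≤ a → f₁ a * f₂ b + f₁ b * f₂ a ≤ f₃ a * f₄ b + f₃ b * f₄ a := by
      intro a b hab
      have e1 := h a b
      have e2 := h b a
      have e3 := h a a
      have e4 := h b b
      simp only [sup_of_le_left hab, inf_of_le_right hab, sup_of_le_right hab,
        inf_of_le_left hab, sup_idem, inf_idem] at e1 e2 e3 e4
      refine ENNReal.add_le_add_of_mul_le_mul e1 e2 ?_
      calc f₁ a * f₂ b * (f₁ b * f₂ a) = (f₁ a * f₂ a) * (f₁ b * f₂ b) := by ring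
        _ ≤ (f₃ a * f₄ a) * (f₃ b * f₄ b) := mul_le_mul' e3 e4
        _ = _ := by ring
    intro a b
    rcases le_total b a with hab | hab
    · exact aux a b hab
    · have := aux b a hab
      rwa [add_comm, add_comm (f₃ a * f₄ b)]
  have hprod : ∀ {g k : ℝ → ℝ≥0∞}, Measurable g → Measurable k →
      ∫⁻ a, ∫⁻ b, (g a * k b + g b * k a) = 2 * ((∫⁻ a, g a) * ∫⁻ b, k b) := by
    intro g k hg hk
    have : ∀ a, ∫⁻ b, (g a * k b + g b * k a) = g a * (∫⁻ b, k b) + (∫⁻ b, g b) * k a := by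
      intro a
      rw [lintegral_add_left (hk.const_mul _), lintegral_const_mul _ hk, lintegral_mul_const _ hg]
    simp only [this]
    rw [lintegral_add_left (hg.mul_const _), lintegral_mul_const _ hg, lintegral_const_mul _ hk]
    ring
  have h2 : 2 * ((∫⁻ a, f₁ a) * ∫⁻ b, f₂ b) ≤ 2 * ((∫⁻ a, f₃ a) * ∫⁻ b, f₄ b) := by
    rw [← hprod h₁ h₂, ← hprod h₃ h₄]
    exact lintegral_mono fun a => lintegral_mono fun b => key a b
  exact (ENNReal.mul_le_mul_iff_right (by simp) (by simp)).1 h2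

lemma lmarginal_four_functions {ι : Type*} [DecidableEq ι] (s : Finset ι)
    {f₁ f₂ f₃ f₄ : (ι → ℝ) → ℝ≥0∞} (h₁ : Measurable f₁)
    (h₂ : Measurable f₂) (h₃ : Measurable f₃) (h₄ : Measurable f₄)
    (h : ∀ a b, f₁ a * f₂ b ≤ f₃ (a ⊔ b) * f₄ (a ⊓ b)) (a b : ι → ℝ) :
    (∫⋯∫⁻_s, f₁ ∂fun _ => volume) a * (∫⋯∫⁻_s, f₂ ∂fun _ => volume) b
      ≤ (∫⋯∫⁻_s, f₃ ∂fun _ => volume) (a ⊔ b) * (∫⋯∫⁻_s, f₄ ∂fun _ => volume) (a ⊓ b) := by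
  induction s using Finset.induction_on generalizing a b with
  | empty => simpa using h a b
  | insert i s hi ih =>
    rw [lmarginal_insert _ h₁ hi, lmarginal_insert _ h₂ hi, lmarginal_insert _ h₃ hi,
      lmarginal_insert _ h₄ hi]
    have hm : ∀ {f : (ι → ℝ) → ℝ≥0∞}, Measurable f → ∀ c : ι → ℝ,
        Measurable fun t => (∫⋯∫⁻_s, f ∂fun _ => volume) (Function.update c i t) :=
      fun hf c => (hf.lmarginal _).comp (measurable_update c)
    refine lintegral_four_functions (hm h₁ a) (hm h₂ b) (hm h₃ _) (hm h₄ _) fun u v => ?_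
    have := ih (Function.update a i u) (Function.update b i v)
    have e1 : Function.update (a ⊔ b) i (u ⊔ v)
        = Function.update a i u ⊔ Function.update b i v := by
      ext j; by_cases hj : j = i
      · subst hj; simp
      · simp [hj]
    have e2 : Function.update (a ⊓ b) i (u ⊓ v)
        = Function.update a i u ⊓ Function.update b i v := by
      ext j; by_cases hj : j = i
      · subst hj; simp
      · simp [hj]
    rwa [e1, e2]

/-- Continuous four functions theorem (Ahlswede–Daykin, Karlin–Rinott). -/
lemma lintegral_pi_four_functions {ι : Type*} [Fintype ι]
    {f₁ f₂ f₃ f₄ : (ι → ℝ) → ℝ≥0∞} (h₁ : Measurable f₁)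
    (h₂ : Measurable f₂) (h₃ : Measurable f₃) (h₄ : Measurable f₄)
    (h : ∀ a b, f₁ a * f₂ b ≤ f₃ (a ⊔ b) * f₄ (a ⊓ b)) :
    (∫⁻ a, f₁ a) * ∫⁻ b, f₂ b ≤ (∫⁻ a, f₃ a) * ∫⁻ b, f₄ b := by
  classical
  have := lmarginal_four_functions Finset.univ h₁ h₂ h₃ h₄ h 0 0
  simpa [lmarginal_univ, ← volume_pi] using this

/-- The Fortuin–Kasteleyn–Ginibre inequality for increasing events under a log-supermodular
density on `ι → ℝ`. -/
lemma withDensity_mul_le_of_supermodular {ι : Type*} [Fintype ι] {ρ : (ι → ℝ) → ℝ≥0∞}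
    (hρ : Measurable ρ) (h : ∀ a b, ρ a * ρ b ≤ ρ (a ⊔ b) * ρ (a ⊓ b)) {A B : Set (ι → ℝ)}
    (hA : MeasurableSet A) (hB : MeasurableSet B) (hA' : IsUpperSet A) (hB' : IsUpperSet B) :
    (volume.withDensity ρ) A * (volume.withDensity ρ) B
      ≤ (volume.withDensity ρ) (A ∩ B) * (volume.withDensity ρ) Set.univ := by
  rw [withDensity_apply _ hA, withDensity_apply _ hB, withDensity_apply _ (hA.inter hB),
    withDensity_apply _ MeasurableSet.univ, ← lintegral_indicator hA, ← lintegral_indicator hB,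
    ← lintegral_indicator (hA.inter hB), Measure.restrict_univ]
  refine lintegral_pi_four_functions (hρ.indicator hA) (hρ.indicator hB)
    (hρ.indicator (hA.inter hB)) hρ fun a b => ?_
  by_cases ha : a ∈ A
  · by_cases hb : b ∈ B
    · have : a ⊔ b ∈ A ∩ B := ⟨hA' le_sup_left ha, hB' le_sup_right hb⟩
      rw [Set.indicator_of_mem ha, Set.indicator_of_mem hb, Set.indicator_of_mem this]
      exact h a b
    · simp [Set.indicator_of_notMem hb]
  · simp [Set.indicator_of_notMem ha]

/-- A process on `⟦0, N⟧` pinned at both ends, whose law is invariant under swapping any two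
consecutive increments, and whose nonnegativity events are positively correlated. -/
structure IsExchangeableBridge {Ω : Type*} [MeasurableSpace Ω] (P : Measure Ω) (N : ℕ)
    (X : ℕ → Ω → ℝ) (x y : ℝ) : Prop where
  measurable : ∀ k, Measurable (X k)
  memLp : ∀ k, MemLp (X k) 2 P
  start : ∀ ω, X 0 ω = x
  finish : ∀ ω, X N ω = y
  swap : ∀ i, 0 < i → i < N → ∃ T : Ω → Ω, MeasurePreserving T P P ∧
    (∀ j, j ≠ i → ∀ ω, X j (T ω) = X j ω) ∧ ∀ ω, X i (T ω) = X (i - 1) ω + X (i + 1) ω - X i ω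
  assoc : ∀ S T : Finset ℕ, P.real {ω | ∀ k ∈ S, 0 ≤ X k ω} * P.real {ω | ∀ k ∈ T, 0 ≤ X k ω}
    ≤ P.real {ω | ∀ k ∈ S ∪ T, 0 ≤ X k ω}

lemma affine_of_midpoint {a : ℕ → ℝ} {t N : ℕ}
    (h : ∀ i, t < i → i < N → a (i - 1) + a (i + 1) = 2 * a i) {k : ℕ} (htk : t ≤ k) (hkN : k ≤ N) :
    ((N : ℝ) - t) * (a k - a N) = ((N : ℝ) - k) * (a t - a N) := by
  have key : ∀ j, t + j ≤ N → a (t + j) = a t + j * (a (t + 1) - a t) := by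
    intro j
    induction j using Nat.strong_induction_on with
    | _ j ih =>
      intro hj
      match j with
      | 0 => simp
      | 1 => simp
      | m + 2 =>
        have h1 := h (t + (m + 1)) (by omega) (by omega)
        have e1 := ih m (by omega) (by omega)
        have e2 := ih (m + 1) (by omega) (by omega)
        rw [show t + (m + 1) - 1 = t + m by omega, show t + (m + 1) + 1 = t + (m + 2) by omega,
          e1, e2] at h1
        push_cast at h1 ⊢
        linarith
  obtain ⟨j, rfl⟩ := Nat.exists_eq_add_of_le htk
  obtain ⟨l, rfl⟩ := Nat.exists_eq_add_of_le (htk.trans hkN)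
  rw [key j hkN, key l le_rfl]
  push_cast
  ring

namespace IsExchangeableBridge

variable {Ω : Type*} [MeasurableSpace Ω] {P : Measure Ω} {N : ℕ} {X : ℕ → Ω → ℝ} {x y : ℝ}

lemma reverse (h : IsExchangeableBridge P N X x y) :
    IsExchangeableBridge P N (fun k => X (N - k)) y x where
  measurable k := h.measurable _
  memLp k := h.memLp _
  start := by simpa using h.finish
  finish := by simpa using h.start
  swap i hi hiN := by
    obtain ⟨T, hT, h1, h2⟩ := h.swap (N - i) (by omega) (by omega)
    refine ⟨T, hT, fun j hj ω => h1 _ (by omega) ω, fun ω => ?_⟩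
    rw [h2, show N - i - 1 = N - (i + 1) by omega, show N - i + 1 = N - (i - 1) by omega]
    ring
  assoc S T := by
    have := h.assoc (S.image (N - ·)) (T.image (N - ·))
    simpa [← Finset.image_union] using this

/-- For an observable `G` of the path up to time `t`, the map `k ↦ E[X k * G]` is affine
on `⟦t, N⟧`. -/
lemma integral_mul_eq (h : IsExchangeableBridge P N X x y) {t k : ℕ} (htk : t ≤ k) (hkN : k ≤ N)
    {G : Ω → ℝ} (hG : MemLp G 2 P)
    (hGt : ∀ ω ω', (∀ j ≤ t, X j ω = X j ω') → G ω = G ω') :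
    ((N : ℝ) - t) * ∫ ω, (X k ω - y) * G ω ∂P = ((N : ℝ) - k) * ∫ ω, (X t ω - y) * G ω ∂P := by
  have hHexp : ∀ k, Integrable (fun ω => X k ω * G ω) P := fun k => (h.memLp k).integrable_mul hG
  have hmid : ∀ i, t < i → i < N → (∫ ω, X (i - 1) ω * G ω ∂P) + ∫ ω, X (i + 1) ω * G ω ∂P
      = 2 * ∫ ω, X i ω * G ω ∂P := by
    intro i hti hiN
    obtain ⟨T, hT, h1, h2⟩ := h.swap i (by omega) hiN
    have hGT : ∀ ω, G (T ω) = G ω := fun ω => hGt _ _ fun j hj => h1 j (by omega) ω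
    have e : ∫ ω, X i (T ω) * G (T ω) ∂P = ∫ ω, X i ω * G ω ∂P := by
      have := integral_map (μ := P) hT.measurable.aemeasurable (f := fun ω => X i ω * G ω)
        (by rw [hT.map_eq]; exact (hHexp i).aestronglyMeasurable)
      rw [← this, hT.map_eq]
    have e2 : ∫ ω, X i (T ω) * G (T ω) ∂P = (∫ ω, X (i - 1) ω * G ω ∂P)
        + (∫ ω, X (i + 1) ω * G ω ∂P) - ∫ ω, X i ω * G ω ∂P := by
      rw [← integral_add (hHexp _) (hHexp _),
        ← integral_sub (f := fun ω => X (i - 1) ω * G ω + X (i + 1) ω * G ω)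
          ((hHexp _).add (hHexp _)) (hHexp _)]
      congr 1; ext ω
      rw [hGT, h2]; ring
    linarith
  have hsub : ∀ k, ∫ ω, (X k ω - y) * G ω ∂P
      = (∫ ω, X k ω * G ω ∂P) - ∫ ω, X N ω * G ω ∂P := by
    intro k
    rw [← integral_sub (hHexp _) (hHexp _)]
    congr 1; ext ω
    rw [h.finish]; ring
  rw [hsub, hsub]
  exact affine_of_midpoint (a := fun k => ∫ ω, X k ω * G ω ∂P) hmid htk hkN

variable [IsProbabilityMeasure P]

lemma integral_eq (h : IsExchangeableBridge P N X x y) {k : ℕ} (hkN : k ≤ N) :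
    (N : ℝ) * ∫ ω, X k ω ∂P = (N - k) * x + k * y := by
  have := h.integral_mul_eq (Nat.zero_le k) hkN (G := fun _ => 1) (memLp_const _) (fun _ _ _ => rfl)
  have hi : Integrable (X k) P := (h.memLp k).integrable (by norm_num)
  simp only [mul_one, Nat.cast_zero, sub_zero, h.start] at this
  rw [integral_sub hi (integrable_const _)] at this
  simp only [integral_const, probReal_univ, smul_eq_mul, one_mul] at this
  linarith

open ProbabilityTheory

lemma covariance_eq (h : IsExchangeableBridge P N X x y) {j k : ℕ} (hjk : j ≤ k) (hkN : k ≤ N) :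
    ((N : ℝ) - j) * cov[X k, X j; P] = ((N : ℝ) - k) * Var[X j; P] := by
  set m := ∫ ω, X j ω ∂P with hm
  have hi : ∀ k, Integrable (X k) P := fun k => (h.memLp k).integrable (by norm_num)
  have hG : MemLp (fun ω => X j ω - m) 2 P := (h.memLp j).sub (memLp_const m)
  have := h.integral_mul_eq hjk hkN hG
    (fun ω ω' hω => by rw [hω j le_rfl])
  have e : ∀ k, ∫ ω, (X k ω - y) * (X j ω - m) ∂P = cov[X k, X j; P] := by
    intro k
    have e1 : Integrable (fun ω => (X k ω - ∫ ω, X k ω ∂P) * (X j ω - m)) P :=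
      ((h.memLp k).sub (memLp_const _)).integrable_mul hG
    have e2 : Integrable (fun ω => ((∫ ω, X k ω ∂P) - y) * (X j ω - m)) P :=
      ((hi j).sub (integrable_const m)).const_mul _
    have e3 : ∫ ω, (X j ω - m) ∂P = 0 := by
      rw [integral_sub (hi j) (integrable_const m)]
      simp [hm]
    calc ∫ ω, (X k ω - y) * (X j ω - m) ∂P
        = ∫ ω, ((X k ω - ∫ ω, X k ω ∂P) * (X j ω - m)
          + ((∫ ω, X k ω ∂P) - y) * (X j ω - m)) ∂P := by congr 1; ext ω; ring
      _ = cov[X k, X j; P] := by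
        rw [integral_add e1 e2, integral_const_mul, e3, mul_zero, add_zero]
        rfl
  rwa [e, e, covariance_self (h.measurable j).aemeasurable] at this

lemma variance_eq (h : IsExchangeableBridge P N X x y) (hN : 2 ≤ N) {j : ℕ} (hjN : j ≤ N) :
    Var[X j; P] = j * (N - j) * (Var[X 1; P] / (N - 1)) := by
  have hN' : (2 : ℝ) ≤ N := by exact_mod_cast hN
  rcases Nat.eq_zero_or_pos j with rfl | hj
  · have : X 0 = fun _ => x := funext h.start
    rw [this, ← covariance_self (by fun_prop)]
    simp
  · have h1 := h.covariance_eq hj hjN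
    have h2 := h.reverse.covariance_eq (j := N - j) (k := N - 1) (by omega) (by omega)
    simp only [show N - (N - j) = j by omega, show N - (N - 1) = 1 by omega] at h2
    rw [Nat.cast_sub hjN, Nat.cast_sub (by omega : 1 ≤ N), covariance_comm] at h2
    have hj' : (j : ℝ) ≠ 0 := by positivity
    have hN1 : (N : ℝ) - 1 ≠ 0 := by linarith
    push_cast at h1 h2
    field_simp
    linear_combination (-(N : ℝ) + 1) * h2 + j * h1

end IsExchangeableBridge

lemma integral_sub_sq {Ω : Type*} [MeasurableSpace Ω] {P : Measure Ω} {f g : Ω → ℝ}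
    (hf : MemLp f 2 P) (hg : MemLp g 2 P) :
    ∫ ω, (f ω - g ω) ^ 2 ∂P
      = (∫ ω, f ω ^ 2 ∂P) - 2 * (∫ ω, f ω * g ω ∂P) + ∫ ω, g ω ^ 2 ∂P := by
  have i2 : Integrable (fun ω => 2 * (f ω * g ω)) P := (hf.integrable_mul hg).const_mul 2
  have i3 : Integrable (fun ω => f ω ^ 2 - 2 * (f ω * g ω)) P := hf.integrable_sq.sub i2
  rw [← integral_const_mul, ← integral_sub hf.integrable_sq i2, ← integral_add i3 hg.integrable_sq]
  congr 1; ext ω; ring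

/-- The slope of the chord joining the path at time `k` to its endpoint; it is a martingale for
an exchangeable bridge. -/
noncomputable def endSlope {Ω : Type*} (N : ℕ) (X : ℕ → Ω → ℝ) (y : ℝ) (k : ℕ) (ω : Ω) : ℝ :=
  (X k ω - y) / ((N : ℝ) - k)

namespace IsExchangeableBridge

variable {Ω : Type*} [MeasurableSpace Ω] {P : Measure Ω} {N : ℕ} {X : ℕ → Ω → ℝ} {x y : ℝ}

lemma integral_endSlope_mul_eq (h : IsExchangeableBridge P N X x y) {t k : ℕ} (htk : t ≤ k)
    (hkN : k < N) {G : Ω → ℝ} (hG : MemLp G 2 P)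
    (hGt : ∀ ω ω', (∀ j ≤ t, X j ω = X j ω') → G ω = G ω') :
    ∫ ω, endSlope N X y k ω * G ω ∂P = ∫ ω, endSlope N X y t ω * G ω ∂P := by
  have h1 := h.integral_mul_eq htk hkN.le hG hGt
  have hk : (0 : ℝ) < N - k := by rw [sub_pos]; exact_mod_cast hkN
  have ht : (0 : ℝ) < N - t := by rw [sub_pos]; exact_mod_cast htk.trans_lt hkN
  have e : ∀ j, ∫ ω, endSlope N X y j ω * G ω ∂P
      = (∫ ω, (X j ω - y) * G ω ∂P) / ((N : ℝ) - j) := by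
    intro j
    rw [← integral_div]
    congr 1; ext ω; unfold endSlope; ring
  rw [e, e, div_eq_div_iff hk.ne' ht.ne']
  linarith

lemma measurable_endSlope (h : IsExchangeableBridge P N X x y) (k : ℕ) :
    Measurable (endSlope N X y k) :=
  ((h.measurable k).sub_const y).div_const _

variable [IsProbabilityMeasure P]

lemma memLp_endSlope (h : IsExchangeableBridge P N X x y) (k : ℕ) :
    MemLp (endSlope N X y k) 2 P := by
  have := ((h.memLp k).sub (memLp_const (μ := P) y)).const_mul ((N : ℝ) - k)⁻¹
  refine this.congr_norm (h.measurable_endSlope k).aestronglyMeasurable (.of_forall fun ω => ?_)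
  simp [endSlope, div_eq_inv_mul]

/-- Kolmogorov's maximal inequality for the chord slopes. -/
lemma maximal_endSlope (h : IsExchangeableBridge P N X x y) {t n : ℕ} (hnN : n < N)
    {a : ℝ} (ha : 0 < a) :
    P.real {ω | ∃ k ∈ Finset.Icc t n, a ≤ |endSlope N X y k ω - endSlope N X y t ω|} * a ^ 2
      ≤ ∫ ω, (endSlope N X y n ω - endSlope N X y t ω) ^ 2 ∂P := by
  set Z : ℕ → Ω → ℝ := fun k ω => endSlope N X y k ω - endSlope N X y t ω with hZ
  have hZm : ∀ k, Measurable (Z k) := fun k =>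
    (h.measurable_endSlope k).sub (h.measurable_endSlope t)
  have hZL : ∀ k, MemLp (Z k) 2 P := fun k => (h.memLp_endSlope k).sub (h.memLp_endSlope t)
  set A : ℕ → Set Ω := fun k => {ω | a ≤ |Z k ω| ∧ ∀ j ∈ Finset.Ico t k, |Z j ω| < a} with hA
  have hAm : ∀ k, MeasurableSet (A k) := by
    intro k
    have e : A k = {ω | a ≤ |Z k ω|} ∩ ⋂ j ∈ Finset.Ico t k, {ω | |Z j ω| < a} := by
      ext ω; simp [hA]
    rw [e]
    refine (measurableSet_le measurable_const (hZm k).abs).inter ?_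
    exact Finset.measurableSet_biInter _ fun j _ => measurableSet_lt (hZm j).abs measurable_const
  have hdis : ((Finset.Icc t n : Finset ℕ) : Set ℕ).PairwiseDisjoint A := by
    have key : ∀ i j, t ≤ i → i < j → Disjoint (A i) (A j) := by
      intro i j hti hij
      rw [Set.disjoint_left]
      rintro ω hi hj
      exact absurd (hj.2 i (Finset.mem_Ico.2 ⟨hti, hij⟩)) (not_lt.2 hi.1)
    intro i hi j hj hij
    simp only [Finset.coe_Icc, Set.mem_Icc] at hi hj
    rcases lt_or_gt_of_ne hij with hlt | hlt
    · exact key i j hi.1 hlt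
    · exact (key j i hj.1 hlt).symm
  have hcover : {ω | ∃ k ∈ Finset.Icc t n, a ≤ |Z k ω|} ⊆ ⋃ k ∈ Finset.Icc t n, A k := by
    rintro ω hω
    classical
    have hω' : ∃ k, k ∈ Finset.Icc t n ∧ a ≤ |Z k ω| := hω
    refine Set.mem_biUnion (Nat.find_spec hω').1 ⟨(Nat.find_spec hω').2, fun j hj => ?_⟩
    by_contra hcon
    have h1 := (Finset.mem_Icc.1 (Nat.find_spec hω').1).2
    rw [Finset.mem_Ico] at hj
    exact Nat.find_min hω' hj.2 ⟨Finset.mem_Icc.2 ⟨hj.1, by omega⟩, not_lt.1 hcon⟩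
  have hsq : ∀ k l, Integrable (fun ω => Z k ω * Z l ω) P := fun k l =>
    (hZL k).integrable_mul (hZL l)
  have hsq2 : ∀ k, Integrable (fun ω => Z k ω ^ 2) P := fun k => (hZL k).integrable_sq
  have hloc : ∀ k ∈ Finset.Icc t n, P.real (A k) * a ^ 2 ≤ ∫ ω in A k, Z n ω ^ 2 ∂P := by
    intro k hk
    rw [Finset.mem_Icc] at hk
    have hpath : ∀ ω ω', (∀ j ≤ k, X j ω = X j ω') →
        (A k).indicator (Z k) ω = (A k).indicator (Z k) ω' := by
      intro ω ω' hω
      have hZe : ∀ j ≤ k, Z j ω = Z j ω' := by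
        intro j hj
        simp only [hZ, endSlope, hω j hj, hω t hk.1]
      have hmem : ω ∈ A k ↔ ω' ∈ A k := by
        simp only [hA, Set.mem_ofPred_eq, hZe k le_rfl]
        refine and_congr_right fun _ => forall₂_congr fun j hj => ?_
        rw [hZe j (Finset.mem_Ico.1 hj).2.le]
      by_cases hc : ω ∈ A k
      · rw [Set.indicator_of_mem hc, Set.indicator_of_mem (hmem.1 hc), hZe k le_rfl]
      · rw [Set.indicator_of_notMem hc, Set.indicator_of_notMem (mt hmem.2 hc)]
    have hG : MemLp ((A k).indicator (Z k)) 2 P := (hZL k).indicator (hAm k)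
    have horth := h.integral_endSlope_mul_eq hk.2 hnN hG hpath
    have e1 : ∫ ω in A k, Z n ω * Z k ω ∂P = ∫ ω in A k, Z k ω ^ 2 ∂P := by
      rw [← integral_indicator (hAm k), ← integral_indicator (hAm k), ← sub_eq_zero,
        ← integral_sub ((hsq _ _).indicator (hAm k)) ((hsq2 _).indicator (hAm k))]
      have i1 : ∀ k', Integrable (fun ω => endSlope N X y k' ω * (A k).indicator (Z k) ω) P :=
        fun k' => (h.memLp_endSlope k').integrable_mul hG
      rw [← sub_eq_zero, ← integral_sub (i1 n) (i1 k)] at horth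
      rw [← horth]
      congr 1; ext ω
      by_cases hc : ω ∈ A k
      · simp only [Set.indicator_of_mem hc, hZ]; ring
      · simp only [Set.indicator_of_notMem hc]; ring
    have e2 : 0 ≤ ∫ ω in A k, (Z n ω - Z k ω) ^ 2 ∂P := integral_nonneg fun ω => sq_nonneg _
    have e3 := integral_sub_sq ((hZL n).restrict (A k)) ((hZL k).restrict (A k))
    have e4 : P.real (A k) • a ^ 2 ≤ ∫ ω in A k, Z k ω ^ 2 ∂P := by
      refine setIntegral_ge_of_const_le (hAm k) (measure_ne_top _ _) (fun ω hω => ?_)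
        (hsq2 _).integrableOn
      rw [← sq_abs (Z k ω)]
      exact pow_le_pow_left₀ ha.le hω.1 2
    rw [smul_eq_mul] at e4
    linarith
  calc P.real {ω | ∃ k ∈ Finset.Icc t n, a ≤ |Z k ω|} * a ^ 2
      ≤ P.real (⋃ k ∈ Finset.Icc t n, A k) * a ^ 2 := by
        exact mul_le_mul_of_nonneg_right (measureReal_mono hcover (measure_ne_top _ _)) (sq_nonneg a)
    _ = ∑ k ∈ Finset.Icc t n, P.real (A k) * a ^ 2 := by
        rw [measureReal_biUnion_finset hdis fun k _ => hAm k, Finset.sum_mul]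
    _ ≤ ∑ k ∈ Finset.Icc t n, ∫ ω in A k, Z n ω ^ 2 ∂P := Finset.sum_le_sum hloc
    _ = ∫ ω in ⋃ k ∈ Finset.Icc t n, A k, Z n ω ^ 2 ∂P :=
        (integral_biUnion_finset _ (fun k _ => hAm k) hdis fun k _ => (hsq2 n).integrableOn).symm
    _ ≤ ∫ ω, Z n ω ^ 2 ∂P := setIntegral_le_integral (hsq2 n) (.of_forall fun ω => sq_nonneg _)

open ProbabilityTheory

lemma integral_sub_endSlope_sq (h : IsExchangeableBridge P N X x y) (hN : 2 ≤ N) {t n : ℕ}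
    (htn : t ≤ n) (hnN : n < N) :
    ∫ ω, (endSlope N X y n ω - endSlope N X y t ω) ^ 2 ∂P
      = (Var[X 1; P] / (N - 1)) * (N * (n - t)) / ((N - n) * (N - t)) := by
  have hn : (0 : ℝ) < N - n := by rw [sub_pos]; exact_mod_cast hnN
  have ht : (0 : ℝ) < N - t := by rw [sub_pos]; exact_mod_cast htn.trans_lt hnN
  have hL := h.memLp_endSlope
  have h0 : ∫ ω, endSlope N X y n ω ∂P = ∫ ω, endSlope N X y t ω ∂P := by
    simpa using h.integral_endSlope_mul_eq htn hnN (memLp_const 1) (fun _ _ _ => rfl)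
  have h1 := h.integral_endSlope_mul_eq htn hnN (hL t)
    (fun ω ω' hω => by simp only [endSlope, hω t le_rfl])
  have hV : ∀ j ≤ N, (∫ ω, endSlope N X y j ω ^ 2 ∂P) - (∫ ω, endSlope N X y j ω ∂P) ^ 2
      = (((N : ℝ) - j)⁻¹) ^ 2 * (j * (N - j) * (Var[X 1; P] / (N - 1))) := by
    intro j hj
    have e : endSlope N X y j = fun ω => ((N : ℝ) - j)⁻¹ * (X j ω - y) := by
      ext ω; simp [endSlope, div_eq_inv_mul]
    have := variance_eq_sub (hL j)
    simp only [Pi.pow_apply] at this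
    rw [← this, e, variance_const_mul, variance_sub_const (h.memLp j).aestronglyMeasurable,
      h.variance_eq hN hj]
  have e3 := integral_sub_sq (hL n) (hL t)
  have h2 : ∫ ω, endSlope N X y t ω * endSlope N X y t ω ∂P = ∫ ω, endSlope N X y t ω ^ 2 ∂P := by
    congr 1; ext ω; ring
  have v1 := hV n hnN.le
  have v2 := hV t (htn.trans hnN.le)
  rw [h0] at v1
  rw [e3, h1, h2]
  have hN1 : (N : ℝ) - 1 ≠ 0 := by
    have : (2 : ℝ) ≤ N := by exact_mod_cast hN
    linarith
  have : (∫ ω, endSlope N X y n ω ^ 2 ∂P) - 2 * (∫ ω, endSlope N X y t ω ^ 2 ∂P)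
        + ∫ ω, endSlope N X y t ω ^ 2 ∂P =
      (((N : ℝ) - n)⁻¹) ^ 2 * (n * (N - n) * (Var[X 1; P] / (N - 1)))
      - (((N : ℝ) - t)⁻¹) ^ 2 * (t * (N - t) * (Var[X 1; P] / (N - 1))) := by linarith
  rw [this]
  field_simp
  ring

end IsExchangeableBridge

section

open ProbabilityTheory

variable {Ω : Type*} [MeasurableSpace Ω] {P : Measure Ω} [IsProbabilityMeasure P]

/-- Paley–Zygmund inequality. -/
lemma paley_zygmund_half {Z : Ω → ℝ} (hZm : Measurable Z) (hZ : MemLp Z 2 P)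
    (hm : 0 < ∫ ω, Z ω ∂P) :
    1 / (4 * (1 + Var[Z; P] / (∫ ω, Z ω ∂P) ^ 2)) ≤ P.real {ω | (∫ ω, Z ω ∂P) / 2 ≤ Z ω} := by
  set m := ∫ ω, Z ω ∂P with hmdef
  set S := ∫ ω, Z ω ^ 2 ∂P with hS
  set E := {ω | m / 2 ≤ Z ω} with hE
  have hEm : MeasurableSet E := measurableSet_le measurable_const hZm
  have hV : Var[Z; P] = S - m ^ 2 := by
    have := variance_eq_sub hZ
    simpa only [Pi.pow_apply] using this
  have hV0 : 0 ≤ Var[Z; P] := variance_nonneg _ _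
  have hSpos : 0 < S := by nlinarith
  have hlam : 0 < m / (4 * S) := by positivity
  have hi : Integrable Z P := hZ.integrable (by norm_num)
  have hpt : ∀ ω, Z ω ≤ m / 2 + (m / (4 * S) * Z ω ^ 2 + E.indicator (fun _ => S / m) ω) := by
    intro ω
    by_cases hω : ω ∈ E
    · rw [Set.indicator_of_mem hω]
      have h1 : 0 ≤ m / (4 * S) * (Z ω - 2 * S / m) ^ 2 := by positivity
      have h2 : m / (4 * S) * (Z ω - 2 * S / m) ^ 2 = m / (4 * S) * Z ω ^ 2 - Z ω + S / m := by
        field_simp; ring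
      linarith
    · rw [Set.indicator_of_notMem hω]
      have h1 : Z ω < m / 2 := not_le.1 hω
      have h2 : 0 ≤ m / (4 * S) * Z ω ^ 2 := by positivity
      linarith
  have i1 : Integrable (fun ω => m / (4 * S) * Z ω ^ 2) P := hZ.integrable_sq.const_mul _
  have i2 : Integrable (E.indicator fun _ => S / m) P := (integrable_const _).indicator hEm
  have i3 : Integrable (fun ω => m / (4 * S) * Z ω ^ 2 + E.indicator (fun _ => S / m) ω) P :=
    i1.add i2
  have h1 : m ≤ m / 2 + (m / (4 * S) * S + P.real E * (S / m)) := by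
    calc m ≤ ∫ ω, (m / 2 + (m / (4 * S) * Z ω ^ 2 + E.indicator (fun _ => S / m) ω)) ∂P :=
          integral_mono hi ((integrable_const _).add i3) hpt
      _ = _ := by
        rw [integral_add (integrable_const _) i3, integral_add i1 i2, integral_const_mul,
          integral_indicator hEm]
        simp [hS]
  have h2 : m / (4 * S) * S = m / 4 := by field_simp
  rw [hV, show 1 + (S - m ^ 2) / m ^ 2 = S / m ^ 2 by field_simp; ring]
  have h3 : m / 4 ≤ P.real E * (S / m) := by linarith
  have h4 : P.real E * (S / m) = P.real E * S / m := by ring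
  rw [h4, le_div_iff₀ hm] at h3
  rw [show 1 / (4 * (S / m ^ 2)) = m / 4 * m / S by field_simp, div_le_iff₀ hSpos]
  exact h3

lemma one_sub_variance_le_half {Z : Ω → ℝ} (hZm : Measurable Z) (hZ : MemLp Z 2 P)
    (hm : 0 < ∫ ω, Z ω ∂P) :
    1 - 4 * (Var[Z; P] / (∫ ω, Z ω ∂P) ^ 2) ≤ P.real {ω | (∫ ω, Z ω ∂P) / 2 ≤ Z ω} := by
  have h1 := meas_ge_le_variance_div_sq hZ (c := (∫ ω, Z ω ∂P) / 2) (by positivity)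
  have h2 : P.real {ω | (∫ ω, Z ω ∂P) / 2 ≤ |Z ω - ∫ ω, Z ω ∂P|}
      ≤ Var[Z; P] / ((∫ ω, Z ω ∂P) / 2) ^ 2 :=
    ENNReal.toReal_le_of_le_ofReal (div_nonneg (variance_nonneg _ _) (sq_nonneg _)) h1
  have h3 : {ω | (∫ ω, Z ω ∂P) / 2 ≤ Z ω}ᶜ ⊆ {ω | (∫ ω, Z ω ∂P) / 2 ≤ |Z ω - ∫ ω, Z ω ∂P|} := by
    intro ω hω
    have : Z ω < (∫ ω, Z ω ∂P) / 2 := not_le.1 hω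
    show (∫ ω, Z ω ∂P) / 2 ≤ |Z ω - ∫ ω, Z ω ∂P|
    rw [abs_of_neg (by linarith)]
    linarith
  have h4 := measureReal_mono (μ := P) h3
  rw [probReal_compl_eq_one_sub (measurableSet_le measurable_const hZm)] at h4
  have h5 : Var[Z; P] / ((∫ ω, Z ω ∂P) / 2) ^ 2 = 4 * (Var[Z; P] / (∫ ω, Z ω ∂P) ^ 2) := by
    field_simp; norm_num
  linarith

end

namespace IsExchangeableBridge

open ProbabilityTheory

variable {Ω : Type*} [MeasurableSpace Ω] {P : Measure Ω} {N : ℕ} {X : ℕ → Ω → ℝ} {x y : ℝ}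
  [IsProbabilityMeasure P]

lemma prob_half_sub_le_block (h : IsExchangeableBridge P N X x y) (hy : 0 ≤ y) (hN : 2 ≤ N)
    {t n : ℕ} (htn : t ≤ n) (hnN : 2 * n ≤ N) (hm : 0 < ∫ ω, X t ω ∂P) :
    P.real {ω | (∫ ω, X t ω ∂P) / 2 ≤ X t ω}
      - 8 * ((Var[X 1; P] / (N - 1)) * N * (n - t) / (∫ ω, X t ω ∂P) ^ 2)
      ≤ P.real {ω | ∀ k ∈ Finset.Icc t n, 0 ≤ X k ω} := by
  set m := ∫ ω, X t ω ∂P with hmdef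
  set κ := Var[X 1; P] / ((N : ℝ) - 1) with hκdef
  have hN' : (2 : ℝ) ≤ N := by exact_mod_cast hN
  have hκ : 0 ≤ κ := div_nonneg (variance_nonneg _ _) (by linarith)
  have hnN' : 2 * (n : ℝ) ≤ N := by exact_mod_cast hnN
  have htn' : (t : ℝ) ≤ n := by exact_mod_cast htn
  have ht : (0 : ℝ) < N - t := by linarith
  have hn : (0 : ℝ) < N - n := by linarith
  set a := m / (2 * ((N : ℝ) - t)) with ha
  have hapos : 0 < a := by positivity
  have hmax := h.maximal_endSlope (t := t) (n := n) (by omega) hapos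
  rw [h.integral_sub_endSlope_sq hN htn (by omega)] at hmax
  set D := {ω | ∃ k ∈ Finset.Icc t n, a ≤ |endSlope N X y k ω - endSlope N X y t ω|} with hD
  have hsub : {ω | m / 2 ≤ X t ω} ⊆ {ω | ∀ k ∈ Finset.Icc t n, 0 ≤ X k ω} ∪ D := by
    intro ω hω
    have hω' : m / 2 ≤ X t ω := hω
    by_cases hωD : ω ∈ D
    · exact Or.inr hωD
    · left
      intro k hk
      have h1 : |endSlope N X y k ω - endSlope N X y t ω| < a := by
        by_contra hcon
        exact hωD ⟨k, hk, not_lt.1 hcon⟩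
      rw [Finset.mem_Icc] at hk
      have hk1 : (t : ℝ) ≤ k := by exact_mod_cast hk.1
      have hk2 : (k : ℝ) ≤ n := by exact_mod_cast hk.2
      have hkN : (0 : ℝ) < N - k := by linarith
      have e : X k ω = ((N : ℝ) - k) / (N - t) * X t ω + (k - t) / (N - t) * y
          + (N - k) * (endSlope N X y k ω - endSlope N X y t ω) := by
        unfold endSlope; field_simp; ring
      have h2 := (abs_lt.1 h1).1
      have h3 : 0 ≤ ((k : ℝ) - t) / (N - t) * y :=
        mul_nonneg (div_nonneg (by linarith) ht.le) hy
      have h4 : ((N : ℝ) - k) / (N - t) * (m / 2) ≤ ((N : ℝ) - k) / (N - t) * X t ω :=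
        mul_le_mul_of_nonneg_left hω' (by positivity)
      have h5 : ((N : ℝ) - k) * (-a) ≤ (N - k) * (endSlope N X y k ω - endSlope N X y t ω) :=
        mul_le_mul_of_nonneg_left h2.le hkN.le
      have h6 : ((N : ℝ) - k) / (N - t) * (m / 2) + ((N : ℝ) - k) * (-a) = 0 := by
        rw [ha]; field_simp; ring
      show 0 ≤ X k ω
      rw [e]; linarith
  have hle := (measureReal_mono (μ := P) hsub).trans (measureReal_union_le _ _)
  have hDle : P.real D ≤ 8 * (κ * N * (n - t) / m ^ 2) := by
    have h1 : P.real D ≤ κ * (N * (n - t)) / ((N - n) * (N - t)) / a ^ 2 := by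
      rwa [le_div_iff₀ (by positivity)]
    refine h1.trans ?_
    have h2 : κ * (N * (n - t)) / ((N - n) * (N - t)) / a ^ 2
        = 4 * (κ * N * (n - t) / m ^ 2) * ((N - t) / (N - n)) := by
      rw [ha]; field_simp; norm_num
    have h3 : ((N : ℝ) - t) / (N - n) ≤ 2 := by
      rw [div_le_iff₀ hn]
      have : (0 : ℝ) ≤ t := Nat.cast_nonneg t
      linarith
    rw [h2]
    have h4 : 0 ≤ 4 * (κ * N * (n - t) / m ^ 2) := by
      have : (0 : ℝ) ≤ n - t := by linarith
      positivity
    nlinarith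
  linarith

lemma block_lower_bounds (h : IsExchangeableBridge P N X x y) (hy : 0 ≤ y) (hN : 2 ≤ N)
    {t n : ℕ} (htn : t ≤ n) (hnN : 2 * n ≤ N) (hm : 0 < ∫ ω, X t ω ∂P) {η b : ℝ} (hη : 0 ≤ η)
    (hnt : (n : ℝ) - t ≤ η * t)
    (hb : (Var[X 1; P] / (N - 1)) * N * t / (∫ ω, X t ω ∂P) ^ 2 ≤ b) :
    1 / (4 * (1 + b)) - 8 * η * b ≤ P.real {ω | ∀ k ∈ Finset.Icc t n, 0 ≤ X k ω} ∧
    1 - (4 + 8 * η) * b ≤ P.real {ω | ∀ k ∈ Finset.Icc t n, 0 ≤ X k ω} := by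
  have h1 := h.prob_half_sub_le_block hy hN htn hnN hm
  have h2 := paley_zygmund_half (h.measurable t) (h.memLp t) hm
  have h3 := one_sub_variance_le_half (h.measurable t) (h.memLp t) hm
  set m := ∫ ω, X t ω ∂P with hmdef
  rw [h.variance_eq hN (by omega : t ≤ N)] at h2 h3
  set κ := Var[X 1; P] / ((N : ℝ) - 1) with hκdef
  have hN' : (2 : ℝ) ≤ N := by exact_mod_cast hN
  have hκ : 0 ≤ κ := div_nonneg (variance_nonneg _ _) (by linarith)
  have ht0 : (0 : ℝ) ≤ t := Nat.cast_nonneg t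
  have htN : (t : ℝ) ≤ N := by exact_mod_cast (by omega : t ≤ N)
  have h4 : t * (N - t) * κ / m ^ 2 ≤ b := by
    refine le_trans (div_le_div_of_nonneg_right ?_ (sq_nonneg m)) hb
    nlinarith [mul_nonneg hκ (mul_nonneg ht0 ht0)]
  have h40 : 0 ≤ t * (N - t) * κ / m ^ 2 := by
    have : (0 : ℝ) ≤ N - t := by linarith
    positivity
  have h5 : κ * N * (n - t) / m ^ 2 ≤ η * b := by
    calc κ * N * (n - t) / m ^ 2 ≤ κ * N * (η * t) / m ^ 2 := by gcongr
      _ = η * (κ * N * t / m ^ 2) := by ring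
      _ ≤ η * b := by gcongr
  have h6 : 1 / (4 * (1 + b)) ≤ 1 / (4 * (1 + t * (N - t) * κ / m ^ 2)) := by
    gcongr
  constructor <;> linarith

end IsExchangeableBridge

lemma exists_exp_neg_mul_le {c : ℝ} (hc : 0 < c) :
    ∃ K ≥ 0, ∀ p q : ℝ, 0 ≤ p → c ≤ q → 1 - p ≤ q → exp (-(K * p)) ≤ q := by
  refine ⟨max 2 (-(2 * log c)), by positivity, fun p q hp hcq hpq => ?_⟩
  rcases le_total p (1 / 2) with h | h
  · have h1 : exp (-(max 2 (-(2 * log c)) * p)) ≤ exp (-(2 * p)) := by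
      gcongr
      exact le_max_left _ _
    have h2 : exp (-(2 * p)) ≤ 1 - p := by
      rw [exp_neg, inv_le_iff_one_le_mul₀ (exp_pos _)]
      nlinarith [add_one_le_exp (2 * p)]
    linarith
  · have h1 : exp (-(max 2 (-(2 * log c)) * p)) ≤ exp (log c) := by
      gcongr
      have h2 : -(2 * log c) ≤ max 2 (-(2 * log c)) := le_max_right _ _
      have h3 : 0 ≤ max 2 (-(2 * log c)) := by positivity
      nlinarith
    rw [exp_log hc] at h1
    linarith

lemma div_one_add_sq_le_quarter (u : ℝ) : u / (1 + u) ^ 2 ≤ 1 / 4 := by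
  rcases eq_or_ne (1 + u) 0 with h | h
  · rw [h]; norm_num
  · rw [div_le_iff₀ (by positivity)]
    nlinarith [sq_nonneg (1 - u)]

/-- Geometric sums of `u ↦ u / (1 + u)^2` are bounded uniformly in the starting point. -/
lemma sum_div_one_add_sq_le {r c : ℝ} (hr : 1 < r) (hc : 0 ≤ c) (n : ℕ) :
    ∑ i ∈ Finset.range n, c * r ^ i / (1 + c * r ^ i) ^ 2 ≤ r / (r - 1) := by
  have hr1 : 0 < r - 1 := by linarith
  have key : ∀ i, c * r ^ i / (1 + c * r ^ i) ^ 2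
      ≤ r / (r - 1) * (c * r ^ (i + 1) / (1 + c * r ^ (i + 1)) - c * r ^ i / (1 + c * r ^ i)) := by
    intro i
    have hu : 0 ≤ c * r ^ i := by positivity
    rw [show c * r ^ (i + 1) = r * (c * r ^ i) by ring]
    generalize c * r ^ i = u at hu
    have h1 : r / (r - 1) * (r * u / (1 + r * u) - u / (1 + u))
        = r * u / ((1 + r * u) * (1 + u)) := by
      have : 1 + r * u ≠ 0 := by positivity
      field_simp
      ring
    rw [h1, div_le_div_iff₀ (by positivity) (by positivity)]
    have : 0 ≤ u * (1 + u) * (r - 1) := by positivity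
    nlinarith
  calc _ ≤ ∑ i ∈ Finset.range n, r / (r - 1) *
        (c * r ^ (i + 1) / (1 + c * r ^ (i + 1)) - c * r ^ i / (1 + c * r ^ i)) :=
        Finset.sum_le_sum fun i _ => key i
    _ = r / (r - 1) * (c * r ^ n / (1 + c * r ^ n) - c * r ^ 0 / (1 + c * r ^ 0)) := by
        rw [← Finset.mul_sum, Finset.sum_range_sub (fun i => c * r ^ i / (1 + c * r ^ i))]
    _ ≤ r / (r - 1) * 1 := by
        gcongr
        have h1 : c * r ^ n / (1 + c * r ^ n) ≤ 1 := by
          rw [div_le_one (by positivity)]; linarith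
        have h2 : 0 ≤ c * r ^ 0 / (1 + c * r ^ 0) := by positivity
        linarith
    _ = _ := mul_one _

lemma mul_div_one_add_sq_le {c z t : ℝ} (hc : 0 ≤ c) (hz : 0 ≤ z) (hzt : z ≤ t)
    (htz : t ≤ 2 * z) : c * t / (1 + c * t) ^ 2 ≤ 2 * (c * z / (1 + c * z) ^ 2) := by
  calc c * t / (1 + c * t) ^ 2 ≤ c * (2 * z) / (1 + c * z) ^ 2 := by gcongr
    _ = _ := by ring

/-- The ratio of the variance to the squared mean of a bridge along the first half. -/
lemma variance_ratio_le {δ C N x y t κN : ℝ} (hδ : 0 < δ) (hC : 0 ≤ C) (hx : 0 < x) (hy : 0 < y)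
    (hxy : x * y = δ * N) (ht : 1 ≤ t) (htN : 2 * t ≤ N)
    (hκ : κN ≤ C * (1 + ((y - x) / N) ^ 2)) :
    κN * t / (((N - t) * x + t * y) / N) ^ 2
      ≤ 4 * C * (1 / δ * (y / (N * x) * t / (1 + y / (N * x) * t) ^ 2)
        + 4 * (1 / N * t / (1 + 1 / N * t) ^ 2) + 4 * (1 * t / (1 + 1 * t) ^ 2)) := by
  have hN : 0 < N := by linarith
  have ht0 : 0 < t := by linarith
  set B := y / N with hB
  have hBpos : 0 < B := by positivity
  have hxB : x * B = δ := by rw [hB, ← mul_div_assoc, hxy]; field_simp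
  set w := x + t * B with hw
  have hwpos : 0 < w := by positivity
  have hm : w / 2 ≤ ((N - t) * x + t * y) / N := by
    rw [show ((N - t) * x + t * y) / N = (1 - t / N) * x + t * B by rw [hB]; field_simp]
    have : t / N ≤ 1 / 2 := by rw [div_le_iff₀ hN]; linarith
    have : 0 ≤ t * B := by positivity
    nlinarith
  have hv : C * (1 + ((y - x) / N) ^ 2) ≤ C * (1 + (x / N) ^ 2 + B ^ 2) := by
    refine mul_le_mul_of_nonneg_left ?_ hC
    have : (y - x) / N = B - x / N := by rw [hB]; ring
    rw [this]
    have : 0 ≤ B * (x / N) := by positivity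
    nlinarith
  have h1 : κN * t / (((N - t) * x + t * y) / N) ^ 2
      ≤ C * (1 + (x / N) ^ 2 + B ^ 2) * t / (w / 2) ^ 2 := by
    have : 0 ≤ C * (1 + (x / N) ^ 2 + B ^ 2) := by positivity
    calc _ ≤ C * (1 + (x / N) ^ 2 + B ^ 2) * t / (((N - t) * x + t * y) / N) ^ 2 := by
          refine div_le_div_of_nonneg_right ?_ (sq_nonneg _)
          exact mul_le_mul_of_nonneg_right (hκ.trans hv) ht0.le
      _ ≤ _ := by gcongr
  refine h1.trans ?_
  have e : C * (1 + (x / N) ^ 2 + B ^ 2) * t / (w / 2) ^ 2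
      = 4 * C * (t / w ^ 2 + (x / N) ^ 2 * t / w ^ 2 + B ^ 2 * t / w ^ 2) := by
    field_simp
    norm_num
  rw [e]
  have t1 : t / w ^ 2 = 1 / δ * (y / (N * x) * t / (1 + y / (N * x) * t) ^ 2) := by
    have e1 : y / (N * x) = B / x := by rw [hB]; field_simp
    rw [e1, ← hxB, hw]
    have : x + t * B ≠ 0 := hwpos.ne'
    field_simp
  have t2 : (x / N) ^ 2 * t / w ^ 2 ≤ 4 * (1 / N * t / (1 + 1 / N * t) ^ 2) := by
    have hxw : x ≤ w := by
      have : 0 ≤ t * B := by positivity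
      linarith
    calc (x / N) ^ 2 * t / w ^ 2 ≤ (w / N) ^ 2 * t / w ^ 2 := by gcongr
      _ = t / N ^ 2 := by field_simp
      _ ≤ 4 * (1 / N * t / (1 + 1) ^ 2) := by
        rw [show 4 * (1 / N * t / (1 + 1) ^ 2) = t / N by ring]
        gcongr
        nlinarith
      _ ≤ _ := by
        gcongr
        rw [one_div, inv_mul_le_iff₀ hN]; linarith
  have t3 : B ^ 2 * t / w ^ 2 ≤ 4 * (1 * t / (1 + 1 * t) ^ 2) := by
    have hBw : t * B ≤ w := by linarith
    calc B ^ 2 * t / w ^ 2 ≤ B ^ 2 * t / (t * B) ^ 2 := by gcongr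
      _ = 4 * (1 * t / (t + 1 * t) ^ 2) := by field_simp; norm_num
      _ ≤ _ := by gcongr
  rw [← t1]
  gcongr

namespace IsExchangeableBridge

open ProbabilityTheory

lemma prod_le {Ω : Type*} [MeasurableSpace Ω] {P : Measure Ω} {N : ℕ} {X : ℕ → Ω → ℝ} {x y : ℝ}
    [IsProbabilityMeasure P] (h : IsExchangeableBridge P N X x y) (S : ℕ → Finset ℕ) (n : ℕ) :
    ∏ i ∈ Finset.range n, P.real {ω | ∀ k ∈ S i, 0 ≤ X k ω}
      ≤ P.real {ω | ∀ k ∈ (Finset.range n).biUnion S, 0 ≤ X k ω} := by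
  induction n with
  | zero => simp
  | succ n ih =>
    rw [Finset.prod_range_succ]
    refine (mul_le_mul_of_nonneg_right ih measureReal_nonneg).trans ((h.assoc _ _).trans_eq ?_)
    rw [Finset.range_add_one, Finset.biUnion_insert, Finset.union_comm]

universe u

lemma exists_first_half_lower_bound {δ C : ℝ} (hδ : 0 < δ) (hC : 0 ≤ C) :
    ∃ ε > 0, ∀ {Ω : Type u} [MeasurableSpace Ω] (P : Measure Ω) [IsProbabilityMeasure P] (N : ℕ)
      (X : ℕ → Ω → ℝ) (x y : ℝ), IsExchangeableBridge P N X x y → 2 ≤ N → 0 < x → 0 < y →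
      x * y = δ * N → Var[X 1; P] / (N - 1) * N ≤ C * (1 + ((y - x) / N) ^ 2) →
      ε ≤ P.real {ω | ∀ k ∈ Finset.Icc 1 (N / 2), 0 ≤ X k ω} := by
  set F : ℝ → ℝ := fun u => u / (1 + u) ^ 2 with hF
  set B := 8 * C * (1 / δ + 8) with hBdef
  have hB : 0 ≤ B := by positivity
  set η := 1 / (64 * (1 + B) ^ 2) with hηdef
  have hη : 0 < η := by positivity
  have hη1 : η ≤ 1 := by
    rw [hηdef, div_le_one (by positivity)]; nlinarith
  obtain ⟨K, hK, hKe⟩ := exists_exp_neg_mul_le (c := 1 / (8 * (1 + B))) (by positivity)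
  set r := 1 + η with hr
  have hr1 : 1 < r := by linarith
  refine ⟨exp (-(K * (12 * (B * (r / (r - 1)))))), exp_pos _, ?_⟩
  intro Ω _ P _ N X x y h hN hx hy hxy hκ
  have hN' : (2 : ℝ) ≤ N := by exact_mod_cast hN
  have hκ0 : 0 ≤ Var[X 1; P] / ((N : ℝ) - 1) := div_nonneg (variance_nonneg _ _) (by linarith)
  set β : ℕ → ℝ := fun i => 8 * C * (1 / δ * F (y / (N * x) * r ^ i) + 4 * F (1 / N * r ^ i)
    + 4 * F (1 * r ^ i)) with hβ
  have hF0 : ∀ u, 0 ≤ u → 0 ≤ F u := fun u hu => by simp only [hF]; positivity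
  have hβ0 : ∀ i, 0 ≤ β i := by
    intro i
    have h1 := hF0 (y / (N * x) * r ^ i) (by positivity)
    have h2 := hF0 (1 / N * r ^ i) (by positivity)
    have h3 := hF0 (1 * r ^ i) (by positivity)
    simp only [hβ]; positivity
  have hβB : ∀ i, β i ≤ B := by
    intro i
    have h1 := div_one_add_sq_le_quarter (y / (N * x) * r ^ i)
    have h2 := div_one_add_sq_le_quarter (1 / N * r ^ i)
    have h3 := div_one_add_sq_le_quarter (1 * r ^ i)
    simp only [hβ, hF, hBdef]
    refine mul_le_mul_of_nonneg_left ?_ (by positivity)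
    have : 1 / δ * (y / (N * x) * r ^ i / (1 + y / (N * x) * r ^ i) ^ 2) ≤ 1 / δ * 1 :=
      mul_le_mul_of_nonneg_left (by linarith) (by positivity)
    linarith
  have hβsum : ∀ n, ∑ i ∈ Finset.range n, β i ≤ B * (r / (r - 1)) := by
    intro n
    have h1 := sum_div_one_add_sq_le hr1 (c := y / (N * x)) (by positivity) n
    have h2 := sum_div_one_add_sq_le hr1 (c := 1 / N) (by positivity) n
    have h3 := sum_div_one_add_sq_le hr1 (c := 1) (by positivity) n
    simp only [hβ, hF, hBdef]
    rw [← Finset.mul_sum, Finset.sum_add_distrib, Finset.sum_add_distrib, ← Finset.mul_sum,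
      ← Finset.mul_sum, ← Finset.mul_sum, mul_assoc (8 * C)]
    refine mul_le_mul_of_nonneg_left ?_ (by positivity)
    have := mul_le_mul_of_nonneg_left h1 (by positivity : 0 ≤ 1 / δ)
    linarith
  set S : ℕ → Finset ℕ := fun i => Finset.Icc ⌈r ^ i⌉₊ (min (⌈r ^ (i + 1)⌉₊ - 1) (N / 2)) with hS
  have hblock : ∀ i, exp (-(K * (12 * β i))) ≤ P.real {ω | ∀ k ∈ S i, 0 ≤ X k ω} := by
    intro i
    set t := ⌈r ^ i⌉₊ with ht
    set n := min (⌈r ^ (i + 1)⌉₊ - 1) (N / 2) with hn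
    have hri : 1 ≤ r ^ i := one_le_pow₀ hr1.le
    have ht1 : 1 ≤ t := Nat.one_le_ceil_iff.2 (by linarith)
    rcases le_or_gt t n with htn | htn
    · have hnN : 2 * n ≤ N := by omega
      have hnr : (n : ℝ) < r ^ (i + 1) := Nat.lt_ceil.1 (by omega)
      have htr : r ^ i ≤ t := Nat.le_ceil _
      have htn' : (t : ℝ) ≤ n := by exact_mod_cast htn
      have ht1' : (1 : ℝ) ≤ t := by exact_mod_cast ht1
      have hnN' : 2 * (n : ℝ) ≤ N := by exact_mod_cast hnN
      have hsucc : r ^ (i + 1) = r ^ i + η * r ^ i := by rw [pow_succ, hr]; ring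
      have ht2 : (t : ℝ) ≤ 2 * r ^ i := by nlinarith
      have hnt : (n : ℝ) - t ≤ η * t := by nlinarith
      have hmean : ∫ ω, X t ω ∂P = ((N - t) * x + t * y) / N := by
        rw [eq_div_iff (by positivity), mul_comm]
        exact h.integral_eq (by omega)
      have hmpos : 0 < ∫ ω, X t ω ∂P := by
        rw [hmean]
        have : (0 : ℝ) < N - t := by linarith
        positivity
      have hb : Var[X 1; P] / (N - 1) * N * t / (∫ ω, X t ω ∂P) ^ 2 ≤ β i := by
        rw [hmean]
        refine (variance_ratio_le hδ hC hx hy hxy ht1' (by linarith) hκ).trans ?_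
        have hr0 : 0 ≤ r ^ i := by linarith
        have h1 := mul_div_one_add_sq_le (c := y / (N * x)) (by positivity) hr0 htr ht2
        have h2 := mul_div_one_add_sq_le (c := 1 / N) (by positivity) hr0 htr ht2
        have h3 := mul_div_one_add_sq_le (c := 1) (by positivity) hr0 htr ht2
        have h4 := mul_le_mul_of_nonneg_left h1 (by positivity : 0 ≤ 1 / δ)
        simp only [hβ, hF]
        rw [show 8 * C = 4 * C * 2 by ring, mul_assoc (4 * C)]
        refine mul_le_mul_of_nonneg_left ?_ (by positivity)
        linarith
      have hb1 := (h.block_lower_bounds hy.le hN htn hnN hmpos hη.le hnt hb).2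
      have hb2 := (h.block_lower_bounds hy.le hN htn hnN hmpos hη.le hnt (hb.trans (hβB i))).1
      refine hKe _ _ (mul_nonneg (by norm_num) (hβ0 i)) (le_trans ?_ hb2) (le_trans ?_ hb1)
      · have e1 : 8 * η * B ≤ 1 / (8 * (1 + B)) := by
          rw [hηdef, le_div_iff₀ (by positivity)]
          have : 8 * (1 / (64 * (1 + B) ^ 2)) * B * (8 * (1 + B)) = B / (1 + B) := by field_simp; norm_num
          rw [this, div_le_one (by positivity)]; linarith
        have e2 : 1 / (4 * (1 + B)) = 2 * (1 / (8 * (1 + B))) := by field_simp; norm_num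
        linarith
      · nlinarith [hβ0 i]
    · have : S i = ∅ := Finset.Icc_eq_empty_of_lt htn
      simp only [this, Finset.notMem_empty, false_imp_iff, implies_true]
      have e : P.real {ω : Ω | True} = 1 := by
        have : {ω : Ω | True} = Set.univ := by ext; simp
        rw [this, probReal_univ]
      rw [e, exp_le_one_iff, neg_nonpos]
      exact mul_nonneg hK (mul_nonneg (by norm_num) (hβ0 i))
  obtain ⟨n, hn⟩ := pow_unbounded_of_one_lt (N : ℝ) hr1
  have hcover : Finset.Icc 1 (N / 2) ⊆ (Finset.range n).biUnion S := by
    intro k hk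
    rw [Finset.mem_Icc] at hk
    obtain ⟨i, hi1, hi2⟩ := exists_nat_pow_near (x := (k : ℝ)) (by exact_mod_cast hk.1) hr1
    have hkN : (k : ℝ) ≤ N := by exact_mod_cast (by omega : k ≤ N)
    rw [Finset.mem_biUnion]
    refine ⟨i, Finset.mem_range.2 ((pow_lt_pow_iff_right₀ hr1).1 (by linarith)), ?_⟩
    rw [Finset.mem_Icc]
    refine ⟨Nat.ceil_le.2 hi1, le_min ?_ hk.2⟩
    have := Nat.lt_ceil.2 hi2
    omega
  calc exp (-(K * (12 * (B * (r / (r - 1))))))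
      ≤ exp (∑ i ∈ Finset.range n, -(K * (12 * β i))) := by
        gcongr
        rw [Finset.sum_neg_distrib, ← Finset.mul_sum, ← Finset.mul_sum]
        have := hβsum n
        gcongr
    _ = ∏ i ∈ Finset.range n, exp (-(K * (12 * β i))) := exp_sum _ _
    _ ≤ ∏ i ∈ Finset.range n, P.real {ω | ∀ k ∈ S i, 0 ≤ X k ω} :=
        Finset.prod_le_prod (fun _ _ => (exp_pos _).le) fun i _ => hblock i
    _ ≤ P.real {ω | ∀ k ∈ (Finset.range n).biUnion S, 0 ≤ X k ω} := h.prod_le S n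
    _ ≤ _ := measureReal_mono fun ω hω k hk => hω k (hcover hk)

/-- An exchangeable, positively associated bridge whose increments have bounded variance stays
nonnegative with probability bounded below when the product of its endpoints is of order `N`. -/
theorem exists_lower_bound {δ C : ℝ} (hδ : 0 < δ) (hC : 0 ≤ C) :
    ∃ ε > 0, ∀ {Ω : Type u} [MeasurableSpace Ω] (P : Measure Ω) [IsProbabilityMeasure P] (N : ℕ)
      (X : ℕ → Ω → ℝ) (x y : ℝ), IsExchangeableBridge P N X x y → 2 ≤ N → 0 < x → 0 < y →
      x * y = δ * N → Var[X 1; P] / (N - 1) * N ≤ C * (1 + ((y - x) / N) ^ 2) →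
      ε ≤ P.real {ω | ∀ k ∈ Finset.Icc 1 (N - 1), 0 ≤ X k ω} := by
  obtain ⟨ε, hε, hbound⟩ := exists_first_half_lower_bound.{u} hδ hC
  refine ⟨ε * ε, by positivity, ?_⟩
  intro Ω _ P _ N X x y h hN hx hy hxy hκ
  have h1 := hbound P N X x y h hN hx hy hxy hκ
  have hvar : Var[X (N - 1); P] = Var[X 1; P] := by
    rw [h.variance_eq hN (by omega : N - 1 ≤ N), Nat.cast_sub (by omega)]
    have : (2 : ℝ) ≤ N := by exact_mod_cast hN
    have : (N : ℝ) - 1 ≠ 0 := by linarith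
    push_cast
    field_simp
    ring
  have h2 := hbound P N _ y x h.reverse hN hy hx (by rw [mul_comm, hxy]) (by
    rw [hvar]
    rwa [show ((x - y) / N) ^ 2 = ((y - x) / N) ^ 2 by ring])
  have h3 : {ω | ∀ k ∈ Finset.Icc 1 (N / 2), 0 ≤ X (N - k) ω}
      = {ω | ∀ k ∈ (Finset.Icc 1 (N / 2)).image (N - ·), 0 ≤ X k ω} := by
    simp only [Finset.forall_mem_image]
  rw [h3] at h2
  calc ε * ε ≤ _ := mul_le_mul h1 h2 hε.le measureReal_nonneg
    _ ≤ _ := h.assoc _ _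
    _ ≤ _ := by
      refine measureReal_mono fun ω hω k hk => hω k ?_
      rw [Finset.mem_Icc] at hk
      rw [Finset.mem_union, Finset.mem_image, Finset.mem_Icc]
      by_cases hkN : k ≤ N / 2
      · exact Or.inl ⟨hk.1, hkN⟩
      · exact Or.inr ⟨N - k, Finset.mem_Icc.2 ⟨by omega, by omega⟩, by omega⟩

end IsExchangeableBridge

section Path

variable {u v : ℝ} {n : ℕ}

lemma pathOf_zero (q : Fin n → ℝ) : pathOf u v n q 0 = u := by
  simp [pathOf]

lemma pathOf_last (q : Fin n → ℝ) : pathOf u v n q (n + 1) = v := by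
  simp [pathOf]

lemma pathOf_succ (q : Fin n → ℝ) (i : Fin n) : pathOf u v n q (i + 1) = q i := by
  have : (i : ℕ) + 1 ≤ n := i.2
  simp [pathOf, this]

lemma continuous_pathOf (k : ℕ) : Continuous fun q => pathOf u v n q k := by
  unfold pathOf
  split_ifs
  · exact continuous_apply _
  · exact continuous_const
  · exact continuous_const

lemma pathOf_mono (k : ℕ) : Monotone fun q => pathOf u v n q k := by
  intro q q' hq
  simp only [pathOf]
  split_ifs
  · exact hq _
  · exact le_rfl
  · exact le_rfl

lemma pathOf_sup (q q' : Fin n → ℝ) (k : ℕ) :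
    pathOf u v n (q ⊔ q') k = max (pathOf u v n q k) (pathOf u v n q' k) := by
  simp only [pathOf]
  split_ifs <;> simp

lemma pathOf_inf (q q' : Fin n → ℝ) (k : ℕ) :
    pathOf u v n (q ⊓ q') k = min (pathOf u v n q k) (pathOf u v n q' k) := by
  simp only [pathOf]
  split_ifs <;> simp

lemma pathOf_update (q : Fin n → ℝ) (i : Fin n) (s : ℝ) (k : ℕ) :
    pathOf u v n (Function.update q i s) k
      = if k = i + 1 then s else pathOf u v n q k := by
  by_cases hk : k = i + 1
  · rw [if_pos hk, hk, pathOf_succ, Function.update_self]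
  · rw [if_neg hk]
    simp only [pathOf]
    split_ifs with h
    · rw [Function.update_of_ne]
      intro hcon
      apply hk
      have := congrArg Fin.val hcon
      simp only at this
      omega
    · rfl
    · rfl

end Path

lemma ConvexOn.continuous_of_univ {H : ℝ → ℝ} (hc : ConvexOn ℝ Set.univ H) : Continuous H :=
  continuousOn_univ.1 (hc.continuousOn isOpen_univ)

section Density

variable {H : ℝ → ℝ} {u v : ℝ} {n : ℕ}

lemma bridgeDensity_pos (q : Fin n → ℝ) : 0 < bridgeDensity H u v n q :=
  Finset.prod_pos fun _ _ => exp_pos _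

lemma continuous_bridgeDensity (hc : ConvexOn ℝ Set.univ H) :
    Continuous (bridgeDensity H u v n) := by
  unfold bridgeDensity
  refine continuous_finsetProd _ fun j _ => ?_
  exact continuous_exp.comp
    (hc.continuous_of_univ.comp ((continuous_pathOf _).sub (continuous_pathOf _))).neg

lemma measurable_ofReal_bridgeDensity (hc : ConvexOn ℝ Set.univ H) :
    Measurable fun q => ENNReal.ofReal (bridgeDensity H u v n q) :=
  (continuous_bridgeDensity hc).measurable.ennreal_ofReal

lemma abs_sub_le_sum_increments (q : Fin n → ℝ) (i : Fin n) :
    |q i - u| ≤ ∑ j ∈ Finset.range (n + 1), |pathOf u v n q (j + 1) - pathOf u v n q j| := by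
  have h1 : q i - u = ∑ j ∈ Finset.range (i + 1), (pathOf u v n q (j + 1) - pathOf u v n q j) := by
    rw [Finset.sum_range_sub, pathOf_succ, pathOf_zero]
  rw [h1]
  refine (Finset.abs_sum_le_sum_abs _ _).trans ?_
  refine Finset.sum_le_sum_of_subset_of_nonneg ?_ fun _ _ _ => abs_nonneg _
  exact Finset.range_subset_range.2 (by have := i.2; omega)

lemma exists_bridgeDensity_le (hc : ConvexOn ℝ Set.univ H)
    (hHexp : Integrable fun x => exp (-(H x))) (u v : ℝ) (n : ℕ) :
    ∃ a > 0, ∃ K ≥ 0, ∀ q : Fin n → ℝ,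
      bridgeDensity H u v n q ≤ K * ∏ i, exp (-(a * |q i - u|)) := by
  obtain ⟨α, hα, β, hgrow⟩ := exists_growth hc hHexp
  refine ⟨α / (n + 1), by positivity, exp ((n + 1) * β), (exp_pos _).le, fun q => ?_⟩
  rw [bridgeDensity, ← exp_sum, ← exp_sum, ← exp_add, exp_le_exp]
  set I : ℝ := ∑ j ∈ Finset.range (n + 1), |pathOf u v n q (j + 1) - pathOf u v n q j| with hI
  have hI0 : 0 ≤ I := Finset.sum_nonneg fun _ _ => abs_nonneg _
  have h1 : ∑ j ∈ Finset.range (n + 1), -(H (pathOf u v n q (j + 1) - pathOf u v n q j))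
      ≤ ∑ j ∈ Finset.range (n + 1),
        (β - α * |pathOf u v n q (j + 1) - pathOf u v n q j|) :=
    Finset.sum_le_sum fun j _ => by linarith [hgrow (pathOf u v n q (j + 1) - pathOf u v n q j)]
  rw [Finset.sum_sub_distrib, ← Finset.mul_sum, ← hI] at h1
  simp only [Finset.sum_const, Finset.card_range, nsmul_eq_mul] at h1
  have h2 : ∑ i, |q i - u| ≤ n * I := by
    calc ∑ i, |q i - u| ≤ ∑ _i : Fin n, I :=
          Finset.sum_le_sum fun i _ => abs_sub_le_sum_increments q i
      _ = n * I := by simp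
  have h3 : α / (n + 1) * ∑ i, |q i - u| ≤ α * I := by
    rw [div_mul_eq_mul_div, div_le_iff₀ (by positivity)]
    nlinarith
  have h4 : ∑ i, -(α / (n + 1) * |q i - u|) = -(α / (n + 1) * ∑ i, |q i - u|) := by
    rw [Finset.mul_sum, Finset.sum_neg_distrib]
  push_cast at h1
  rw [h4]
  linarith

lemma integrable_prod_exp_neg_abs {a : ℝ} (ha : 0 < a) (u : ℝ) (n : ℕ) :
    Integrable fun q : Fin n → ℝ => ∏ i, exp (-(a * |q i - u|)) :=
  Integrable.fintype_prod (μ := fun _ => volume) fun _ =>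
    (integrable_exp_neg_abs ha).comp_sub_right u

lemma integrable_bridgeDensity (hc : ConvexOn ℝ Set.univ H)
    (hHexp : Integrable fun x => exp (-(H x))) : Integrable (bridgeDensity H u v n) := by
  obtain ⟨a, ha, K, hK, hle⟩ := exists_bridgeDensity_le hc hHexp u v n
  refine ((integrable_prod_exp_neg_abs ha u n).const_mul K).mono'
    (continuous_bridgeDensity hc).aestronglyMeasurable (.of_forall fun q => ?_)
  rw [norm_of_nonneg (bridgeDensity_pos q).le]
  exact hle q

lemma sq_le_mul_exp {a : ℝ} (ha : 0 < a) (s : ℝ) : s ^ 2 ≤ 8 / a ^ 2 * exp (a / 2 * |s|) := by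
  have h := quadratic_le_exp_of_nonneg (x := a / 2 * |s|) (by positivity)
  have h1 : (a / 2 * |s|) ^ 2 = a ^ 2 / 4 * s ^ 2 := by rw [mul_pow, sq_abs]; ring
  have h2 : 0 ≤ a / 2 * |s| := by positivity
  rw [div_mul_eq_mul_div, le_div_iff₀ (by positivity)]
  rw [h1] at h
  linarith

lemma integrable_sq_mul_bridgeDensity (hc : ConvexOn ℝ Set.univ H)
    (hHexp : Integrable fun x => exp (-(H x))) (i : Fin n) :
    Integrable fun q => (q i - u) ^ 2 * bridgeDensity H u v n q := by
  obtain ⟨a, ha, K, hK, hle⟩ := exists_bridgeDensity_le hc hHexp u v n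
  refine ((integrable_prod_exp_neg_abs (half_pos ha) u n).const_mul (8 / a ^ 2 * K)).mono'
    ((by fun_prop : Continuous fun q : Fin n → ℝ => (q i - u) ^ 2).mul
      (continuous_bridgeDensity hc)).aestronglyMeasurable (.of_forall fun q => ?_)
  rw [norm_of_nonneg (mul_nonneg (sq_nonneg _) (bridgeDensity_pos q).le)]
  have h1 : exp (a / 2 * |q i - u|) * ∏ i, exp (-(a * |q i - u|))
      ≤ ∏ i, exp (-(a / 2 * |q i - u|)) := by
    rw [← exp_sum, ← exp_sum, ← exp_add, exp_le_exp, Finset.sum_neg_distrib,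
      Finset.sum_neg_distrib, ← Finset.mul_sum, ← Finset.mul_sum]
    have := Finset.single_le_sum (f := fun i => |q i - u|) (fun _ _ => abs_nonneg _)
      (Finset.mem_univ i)
    nlinarith
  calc (q i - u) ^ 2 * bridgeDensity H u v n q
      ≤ (8 / a ^ 2 * exp (a / 2 * |q i - u|)) * (K * ∏ i, exp (-(a * |q i - u|))) :=
        mul_le_mul (sq_le_mul_exp ha _) (hle q) (bridgeDensity_pos q).le (by positivity)
    _ = 8 / a ^ 2 * K * (exp (a / 2 * |q i - u|) * ∏ i, exp (-(a * |q i - u|))) := by ring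
    _ ≤ _ := by gcongr

lemma convex_add_le_add {H : ℝ → ℝ} (hc : ConvexOn ℝ Set.univ H) {p r s t : ℝ} (hps : p ≤ s)
    (hsr : s ≤ r) (hst : s + t = p + r) : H s + H t ≤ H p + H r := by
  rcases eq_or_lt_of_le (hps.trans hsr) with h | h
  · have h1 : s = p := by linarith
    have h2 : t = r := by linarith
    rw [h1, h2]
  · have hpr : 0 < r - p := by linarith
    set l := (s - p) / (r - p) with hl
    have hl0 : 0 ≤ l := div_nonneg (by linarith) hpr.le
    have hl1 : l ≤ 1 := by rw [hl, div_le_one hpr]; linarith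
    have hlm : l * (r - p) = s - p := by rw [hl]; field_simp
    have h1 := hc.2 (Set.mem_univ p) (Set.mem_univ r) (by linarith : 0 ≤ 1 - l) hl0 (by ring)
    have h2 := hc.2 (Set.mem_univ p) (Set.mem_univ r) hl0 (by linarith : 0 ≤ 1 - l) (by ring)
    simp only [smul_eq_mul] at h1 h2
    rw [show (1 - l) * p + l * r = s by linarith] at h1
    rw [show l * p + (1 - l) * r = t by linarith] at h2
    linarith

lemma convex_increment_submodular {H : ℝ → ℝ} (hc : ConvexOn ℝ Set.univ H) (a a' b b' : ℝ) :
    H (max a' b' - max a b) + H (min a' b' - min a b) ≤ H (a' - a) + H (b' - b) := by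
  rcases le_total a b with h | h <;> rcases le_total a' b' with h' | h'
  · rw [max_eq_right h, max_eq_right h', min_eq_left h, min_eq_left h', add_comm]
  · rw [max_eq_right h, max_eq_left h', min_eq_left h, min_eq_right h', add_comm (H (a' - a))]
    exact convex_add_le_add hc (by linarith) (by linarith) (by ring)
  · rw [max_eq_left h, max_eq_right h', min_eq_right h, min_eq_left h']
    exact convex_add_le_add hc (by linarith) (by linarith) (by ring)
  · rw [max_eq_left h, max_eq_left h', min_eq_right h, min_eq_right h']

lemma bridgeDensity_supermodular (hc : ConvexOn ℝ Set.univ H) (q q' : Fin n → ℝ) :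
    bridgeDensity H u v n q * bridgeDensity H u v n q'
      ≤ bridgeDensity H u v n (q ⊔ q') * bridgeDensity H u v n (q ⊓ q') := by
  simp only [bridgeDensity, ← Finset.prod_mul_distrib, ← exp_add]
  refine Finset.prod_le_prod (fun _ _ => (exp_pos _).le) fun j _ => ?_
  rw [exp_le_exp, pathOf_sup, pathOf_sup, pathOf_inf, pathOf_inf]
  linarith [convex_increment_submodular hc (pathOf u v n q j) (pathOf u v n q (j + 1))
    (pathOf u v n q' j) (pathOf u v n q' (j + 1))]

/-- Reflection of one coordinate that swaps the two increments around it. -/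
noncomputable def swapIncrements (u v : ℝ) (n : ℕ) (i : Fin n) (q : Fin n → ℝ) : Fin n → ℝ :=
  Function.update q i (pathOf u v n q i + pathOf u v n q (i + 2) - q i)

lemma bridgeDensity_swapIncrements (i : Fin n) (q : Fin n → ℝ) :
    bridgeDensity H u v n (swapIncrements u v n i q) = bridgeDensity H u v n q := by
  have hi := i.2
  refine Finset.prod_equiv (Equiv.swap (i : ℕ) (i + 1)) (fun j => ?_) fun j _ => ?_
  · simp only [Finset.mem_range]
    rcases eq_or_ne j i with rfl | h1
    · rw [Equiv.swap_apply_left]; omega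
    · rcases eq_or_ne j (i + 1) with rfl | h2
      · rw [Equiv.swap_apply_right]; omega
      · rw [Equiv.swap_apply_of_ne_of_ne h1 h2]
  · congr 3
    simp only [swapIncrements, pathOf_update]
    rcases eq_or_ne j i with rfl | h1
    · rw [Equiv.swap_apply_left, if_pos rfl, if_neg (by omega), pathOf_succ]
      ring
    · rcases eq_or_ne j (i + 1) with rfl | h2
      · rw [Equiv.swap_apply_right, if_neg (by omega), if_pos rfl, pathOf_succ]
        ring
      · rw [Equiv.swap_apply_of_ne_of_ne h1 h2, if_neg (by omega), if_neg h2]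

lemma continuous_swapIncrements (i : Fin n) : Continuous (swapIncrements u v n i) :=
  continuous_id.update i
    (((continuous_pathOf _).add (continuous_pathOf _)).sub (continuous_apply i))

lemma lintegral_comp_swapIncrements (i : Fin n) {f : (Fin n → ℝ) → ℝ≥0∞} (hf : Measurable f) :
    ∫⁻ q, f (swapIncrements u v n i q) = ∫⁻ q, f q := by
  refine lintegral_eq_of_lmarginal_eq (μ := fun _ => volume) {i}
    (hf.comp (continuous_swapIncrements i).measurable) hf ?_
  rw [lmarginal_singleton, lmarginal_singleton]
  ext q
  have e : ∀ s, f (swapIncrements u v n i (Function.update q i s))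
      = f (Function.update q i (pathOf u v n q i + pathOf u v n q (i + 2) - s)) := by
    intro s
    simp only [swapIncrements, pathOf_update, Function.update_idem, Function.update_self]
    rw [if_neg (by omega), if_neg (by omega)]
  simp only [e]
  exact lintegral_sub_left_eq_self (μ := volume) (fun s => f (Function.update q i s)) _

lemma measurePreserving_swapIncrements (hc : ConvexOn ℝ Set.univ H) (i : Fin n) :
    MeasurePreserving (swapIncrements u v n i) (bridgeMeasure H u v n) (bridgeMeasure H u v n) := by
  have hm : Measurable (swapIncrements u v n i) := (continuous_swapIncrements i).measurable
  refine ⟨hm, Measure.ext fun S hS => ?_⟩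
  have hρ := measurable_ofReal_bridgeDensity (H := H) (u := u) (v := v) (n := n) hc
  rw [Measure.map_apply hm hS, bridgeMeasure, withDensity_apply _ (hm hS), withDensity_apply _ hS,
    ← lintegral_indicator (hm hS), ← lintegral_indicator hS,
    ← lintegral_comp_swapIncrements (u := u) (v := v) i (hρ.indicator hS)]
  congr 1; ext q
  simp only [Set.indicator, bridgeDensity_swapIncrements]
  rfl

end Density

namespace IsExchangeableBridge

open ProbabilityTheory

lemma variance_first_le {Ω : Type*} [MeasurableSpace Ω] {P : Measure Ω} [IsProbabilityMeasure P]
    {N : ℕ} {X : ℕ → Ω → ℝ} {x y C : ℝ} (h : IsExchangeableBridge P N X x y) (hN : 2 ≤ N)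
    (hpair : ∫ ω, (X 1 ω - (X 0 ω + X 2 ω) / 2) ^ 2 ∂P
      ≤ ∫ ω, (C + 3 / 4 * ((X 2 ω - X 0 ω) / 2) ^ 2) ∂P) :
    Var[X 1; P] / (N - 1) * N ≤ 8 * C + 6 * ((y - x) / N) ^ 2 := by
  have hN' : (2 : ℝ) ≤ N := by exact_mod_cast hN
  have hκ : 0 ≤ Var[X 1; P] / ((N : ℝ) - 1) := div_nonneg (variance_nonneg _ _) (by linarith)
  have v1 := h.variance_eq hN (j := 1) (by omega)
  have v2 := h.variance_eq hN hN
  have hcov := h.covariance_eq (j := 1) (k := 2) (by norm_num) hN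
  have hm := h.integral_eq hN
  rw [v1] at hcov
  set κ := Var[X 1; P] / ((N : ℝ) - 1) with hκdef
  push_cast at v1 v2 hcov hm
  have hcov' : cov[X 2, X 1; P] = (N - 2) * κ := by
    have : (N : ℝ) - 1 ≠ 0 := by linarith
    apply mul_left_cancel₀ this
    rw [hcov]; ring
  have hhalf : MemLp (fun ω => 1 / 2 * X 2 ω) 2 P := (h.memLp 2).const_mul _
  have hL : MemLp (fun ω => X 1 ω - 1 / 2 * X 2 ω) 2 P := (h.memLp 1).sub hhalf
  have hW : MemLp (fun ω => X 1 ω - 1 / 2 * X 2 ω - x / 2) 2 P := hL.sub (memLp_const _)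
  have hA : κ * N / 2 ≤ ∫ ω, (X 1 ω - (X 0 ω + X 2 ω) / 2) ^ 2 ∂P := by
    have e1 := variance_eq_sub hW
    rw [variance_sub_const hL.aestronglyMeasurable, variance_fun_sub (h.memLp 1) hhalf,
      variance_const_mul, covariance_const_mul_right, covariance_comm, hcov', v1, v2] at e1
    have e2 : ∫ ω, (X 1 ω - (X 0 ω + X 2 ω) / 2) ^ 2 ∂P
        = ∫ ω, ((fun ω => X 1 ω - 1 / 2 * X 2 ω - x / 2) ^ 2) ω ∂P := by
      congr 1; ext ω
      simp only [Pi.pow_apply, h.start]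
      ring
    rw [e2]
    nlinarith [sq_nonneg (∫ ω, X 1 ω - 1 / 2 * X 2 ω - x / 2 ∂P)]
  have hB : ∫ ω, (C + 3 / 4 * ((X 2 ω - X 0 ω) / 2) ^ 2) ∂P
      = C + 3 / 4 * (((y - x) / N) ^ 2 + κ * (N - 2) / 2) := by
    have hS : MemLp (fun ω => X 2 ω - x) 2 P := (h.memLp 2).sub (memLp_const _)
    have e1 := variance_eq_sub hS
    rw [variance_sub_const (h.memLp 2).aestronglyMeasurable, v2,
      integral_sub ((h.memLp 2).integrable (by norm_num)) (integrable_const _)] at e1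
    have e2 : ∀ ω, C + 3 / 4 * ((X 2 ω - X 0 ω) / 2) ^ 2
        = C + 3 / 16 * (X 2 ω - x) ^ 2 := by
      intro ω
      rw [h.start]
      ring
    simp only [e2]
    simp only [Pi.pow_apply] at e1
    rw [integral_add (integrable_const _) (hS.integrable_sq.const_mul _), integral_const_mul]
    have e3 : ∫ ω, X 2 ω ∂P - x = 2 * ((y - x) / N) := by
      field_simp
      linarith
    simp only [integral_const, probReal_univ, smul_eq_mul, one_mul, e3] at e1 ⊢
    linarith
  rw [hB] at hpair
  nlinarith

end IsExchangeableBridge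

section Normalized

variable {H : ℝ → ℝ} {u v : ℝ} {n : ℕ}

lemma exists_lintegral_second_difference_le (hc : ConvexOn ℝ Set.univ H)
    (hHexp : Integrable fun x => exp (-(H x))) :
    ∃ C ≥ 0, ∀ (u v : ℝ) (n : ℕ), 1 ≤ n →
      ∫⁻ q, ENNReal.ofReal ((pathOf u v n q 1 - (pathOf u v n q 0 + pathOf u v n q 2) / 2) ^ 2
        * bridgeDensity H u v n q)
      ≤ ∫⁻ q, ENNReal.ofReal ((C + 3 / 4 * ((pathOf u v n q 2 - pathOf u v n q 0) / 2) ^ 2)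
        * bridgeDensity H u v n q) := by
  obtain ⟨C, hC, hpair⟩ := exists_pair_second_moment_le hc hHexp
  refine ⟨C, hC, fun u v n hn => ?_⟩
  obtain ⟨m, rfl⟩ := Nat.exists_eq_add_of_le' hn
  have hρ := continuous_bridgeDensity (H := H) (u := u) (v := v) (n := m + 1) hc
  have hX : ∀ k, Continuous fun q => pathOf u v (m + 1) q k := continuous_pathOf
  refine lintegral_le_of_lmarginal_le (μ := fun _ => volume) {0}
    ((((hX 1).sub (((hX 0).add (hX 2)).div_const 2)).pow 2).mul hρ).measurable.ennreal_ofReal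
    ((continuous_const.add (continuous_const.mul
      ((((hX 2).sub (hX 0)).div_const 2).pow 2))).mul hρ).measurable.ennreal_ofReal ?_
  rw [lmarginal_singleton, lmarginal_singleton]
  intro q
  set b := pathOf u v (m + 1) q 2 with hb
  set R := ∏ j ∈ Finset.range m,
    exp (-(H (pathOf u v (m + 1) q (j + 3) - pathOf u v (m + 1) q (j + 2)))) with hR
  have hR0 : 0 ≤ R := Finset.prod_nonneg fun _ _ => (exp_pos _).le
  have h0 : ∀ s, pathOf u v (m + 1) (Function.update q 0 s) 0 = u := fun s => pathOf_zero _
  have h1 : ∀ s, pathOf u v (m + 1) (Function.update q 0 s) 1 = s := by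
    intro s; rw [pathOf_update]; simp
  have h2 : ∀ k s, pathOf u v (m + 1) (Function.update q 0 s) (k + 2)
      = pathOf u v (m + 1) q (k + 2) := by
    intro k s; rw [pathOf_update]; simp
  have hdens : ∀ s, bridgeDensity H u v (m + 1) (Function.update q 0 s)
      = R * exp (-(H (s - u) + H (b - s))) := by
    intro s
    rw [bridgeDensity, Finset.prod_range_succ', Finset.prod_range_succ', neg_add, exp_add]
    simp only [zero_add, h0, h1, h2 0, h2, show ∀ j, j + 1 + 1 + 1 = (j + 1) + 2 from fun _ => rfl,
      show (1 + 1 : ℕ) = 0 + 2 from rfl, show ∀ j, j + 1 + 1 = j + 2 from fun _ => rfl]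
    rw [hR, hb]
    ring
  set c := (b - u) / 2 with hcdef
  have hL : ∀ w, ENNReal.ofReal (((w + (u + b) / 2) - (u + b) / 2) ^ 2
      * (R * exp (-(H (w + (u + b) / 2 - u) + H (b - (w + (u + b) / 2))))))
      = ENNReal.ofReal R * ENNReal.ofReal (w ^ 2 * exp (-(H (c + w) + H (c - w)))) := by
    intro w
    rw [← ENNReal.ofReal_mul hR0, show w + (u + b) / 2 - u = c + w by rw [hcdef]; ring,
      show b - (w + (u + b) / 2) = c - w by rw [hcdef]; ring]
    congr 1; ring
  have hRt : ∀ w, ENNReal.ofReal ((C + 3 / 4 * c ^ 2)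
      * (R * exp (-(H (w + (u + b) / 2 - u) + H (b - (w + (u + b) / 2))))))
      = ENNReal.ofReal R
        * ENNReal.ofReal ((C + 3 / 4 * c ^ 2) * exp (-(H (c + w) + H (c - w)))) := by
    intro w
    rw [← ENNReal.ofReal_mul hR0, show w + (u + b) / 2 - u = c + w by rw [hcdef]; ring,
      show b - (w + (u + b) / 2) = c - w by rw [hcdef]; ring]
    congr 1; ring
  have h2' : ∀ s, pathOf u v (m + 1) (Function.update q 0 s) 2 = b := h2 0
  simp only [hdens, h0, h1, h2']
  rw [← lintegral_add_right_eq_self _ ((u + b) / 2),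
    ← lintegral_add_right_eq_self (fun s => ENNReal.ofReal ((C + 3 / 4 * c ^ 2) *
      (R * exp (-(H (s - u) + H (b - s)))))) ((u + b) / 2)]
  simp only [hL, hRt]
  rw [lintegral_const_mul' _ _ ENNReal.ofReal_ne_top, lintegral_const_mul' _ _ ENNReal.ofReal_ne_top]
  exact mul_le_mul_of_nonneg_left (hpair c) zero_le

lemma bridgeMeasure_univ_ne_top (hc : ConvexOn ℝ Set.univ H)
    (hHexp : Integrable fun x => exp (-(H x))) : bridgeMeasure H u v n Set.univ ≠ ∞ := by
  rw [bridgeMeasure, withDensity_apply _ .univ, Measure.restrict_univ]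
  exact ((integrable_bridgeDensity hc hHexp).lintegral_lt_top).ne

lemma bridgeMeasure_univ_ne_zero (hc : ConvexOn ℝ Set.univ H) :
    bridgeMeasure H u v n Set.univ ≠ 0 := by
  rw [bridgeMeasure, withDensity_apply _ .univ, Measure.restrict_univ, Ne,
    lintegral_eq_zero_iff (measurable_ofReal_bridgeDensity hc)]
  intro h
  have h1 : ∀ᵐ _q : Fin n → ℝ, False := by
    filter_upwards [h] with q hq
    exact absurd (ENNReal.ofReal_eq_zero.1 hq) (not_le.2 (bridgeDensity_pos q))
  rw [Filter.eventually_false_iff_eq_bot, ae_eq_bot] at h1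
  exact (NeZero.ne (volume : Measure (Fin n → ℝ))) h1

lemma isProbabilityMeasure_normalizeMeasure {α : Type*} [MeasurableSpace α] {μ : Measure α}
    (h0 : μ Set.univ ≠ 0) (ht : μ Set.univ ≠ ∞) : IsProbabilityMeasure (normalizeMeasure μ) :=
  ⟨by rw [normalizeMeasure, Measure.smul_apply, smul_eq_mul, ENNReal.inv_mul_cancel h0 ht]⟩

lemma memLp_pathOf (hc : ConvexOn ℝ Set.univ H) (hHexp : Integrable fun x => exp (-(H x))) (k : ℕ) :
    MemLp (fun q => pathOf u v n q k) 2 (normalizeMeasure (bridgeMeasure H u v n)) := by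
  have h0 := bridgeMeasure_univ_ne_zero (u := u) (v := v) (n := n) hc
  have ht := bridgeMeasure_univ_ne_top (u := u) (v := v) (n := n) hc hHexp
  have : IsFiniteMeasure (bridgeMeasure H u v n) := ⟨lt_top_iff_ne_top.2 ht⟩
  refine MemLp.smul_measure ?_ (ENNReal.inv_ne_top.2 h0)
  unfold pathOf
  split_ifs with hk
  · set i : Fin n := ⟨k - 1, by omega⟩
    have h1 : MemLp (fun q : Fin n → ℝ => q i - u) 2 (bridgeMeasure H u v n) := by
      have hm : Measurable fun q : Fin n → ℝ => q i - u :=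
        ((continuous_apply i).sub continuous_const).measurable
      rw [memLp_two_iff_integrable_sq hm.aestronglyMeasurable,
        bridgeMeasure,
        integrable_withDensity_iff (measurable_ofReal_bridgeDensity hc)
          (.of_forall fun _ => ENNReal.ofReal_lt_top)]
      simp only [ENNReal.toReal_ofReal (bridgeDensity_pos _).le]
      exact integrable_sq_mul_bridgeDensity hc hHexp i
    convert h1.add (memLp_const u) using 1
    ext q
    simp
  · exact memLp_const _
  · exact memLp_const _

lemma isExchangeableBridge_pathOf (hc : ConvexOn ℝ Set.univ H)
    (hHexp : Integrable fun x => exp (-(H x))) :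
    IsExchangeableBridge (normalizeMeasure (bridgeMeasure H u v n)) (n + 1)
      (fun k q => pathOf u v n q k) u v where
  measurable k := (continuous_pathOf k).measurable
  memLp := memLp_pathOf hc hHexp
  start := pathOf_zero
  finish := pathOf_last
  swap i hi hiN := by
    obtain ⟨j, rfl⟩ := Nat.exists_eq_add_of_le' hi
    refine ⟨swapIncrements u v n ⟨j, by omega⟩, ?_, fun k hk q => ?_, fun q => ?_⟩
    · have h := measurePreserving_swapIncrements (u := u) (v := v) (n := n) hc ⟨j, by omega⟩
      exact ⟨h.measurable, by rw [normalizeMeasure, Measure.map_smul, h.map_eq]⟩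
    · rw [swapIncrements, pathOf_update, if_neg hk]
    · rw [swapIncrements, pathOf_update, if_pos rfl,
        ← pathOf_succ (u := u) (v := v) q ⟨j, by omega⟩]
      rfl
  assoc S T := by
    set μ := bridgeMeasure H u v n with hμ
    have h0 : μ Set.univ ≠ 0 := bridgeMeasure_univ_ne_zero hc
    have ht : μ Set.univ ≠ ∞ := bridgeMeasure_univ_ne_top hc hHexp
    have hmeas : ∀ S : Finset ℕ, MeasurableSet {q | ∀ k ∈ S, 0 ≤ pathOf u v n q k} := by
      intro S
      have e : {q | ∀ k ∈ S, 0 ≤ pathOf u v n q k} = ⋂ k ∈ S, {q | 0 ≤ pathOf u v n q k} := by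
        ext q; simp
      rw [e]
      exact Finset.measurableSet_biInter _ fun k _ =>
        measurableSet_le measurable_const (continuous_pathOf k).measurable
    have hup : ∀ S : Finset ℕ, IsUpperSet {q | ∀ k ∈ S, 0 ≤ pathOf u v n q k} :=
      fun S q q' hqq hq k hk => (hq k hk).trans (pathOf_mono k hqq)
    have hfkg := withDensity_mul_le_of_supermodular
      (measurable_ofReal_bridgeDensity (H := H) (u := u) (v := v) (n := n) hc)
      (fun a b => by
        rw [← ENNReal.ofReal_mul (bridgeDensity_pos _).le,
          ← ENNReal.ofReal_mul (bridgeDensity_pos _).le]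
        exact ENNReal.ofReal_le_ofReal (bridgeDensity_supermodular hc a b))
      (hmeas S) (hmeas T) (hup S) (hup T)
    have hcap : {q | ∀ k ∈ S, 0 ≤ pathOf u v n q k} ∩ {q | ∀ k ∈ T, 0 ≤ pathOf u v n q k}
        = {q | ∀ k ∈ S ∪ T, 0 ≤ pathOf u v n q k} := by
      ext q
      simp only [Finset.mem_union, or_imp, forall_and]
      rfl
    rw [hcap] at hfkg
    change μ _ * μ _ ≤ μ _ * μ Set.univ at hfkg
    have : IsProbabilityMeasure (normalizeMeasure μ) :=
      isProbabilityMeasure_normalizeMeasure h0 ht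
    rw [measureReal_def, measureReal_def, measureReal_def, ← ENNReal.toReal_mul]
    refine ENNReal.toReal_mono (measure_ne_top _ _) ?_
    simp only [normalizeMeasure, Measure.smul_apply, smul_eq_mul]
    set A := μ {q | ∀ k ∈ S, 0 ≤ pathOf u v n q k}
    set B := μ {q | ∀ k ∈ T, 0 ≤ pathOf u v n q k}
    set D := μ {q | ∀ k ∈ S ∪ T, 0 ≤ pathOf u v n q k}
    set Z := μ Set.univ
    calc Z⁻¹ * A * (Z⁻¹ * B) = Z⁻¹ * Z⁻¹ * (A * B) := by ring
      _ ≤ Z⁻¹ * Z⁻¹ * (D * Z) := by gcongr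
      _ = Z⁻¹ * D * (Z⁻¹ * Z) := by ring
      _ = Z⁻¹ * D := by rw [ENNReal.inv_mul_cancel h0 ht, mul_one]

lemma ofReal_integral_normalizeMeasure (hc : ConvexOn ℝ Set.univ H) {f : (Fin n → ℝ) → ℝ}
    (hf : Integrable f (normalizeMeasure (bridgeMeasure H u v n))) (hf0 : ∀ q, 0 ≤ f q) :
    ENNReal.ofReal (∫ q, f q ∂normalizeMeasure (bridgeMeasure H u v n))
      = (bridgeMeasure H u v n Set.univ)⁻¹
        * ∫⁻ q, ENNReal.ofReal (f q * bridgeDensity H u v n q) := by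
  rw [ofReal_integral_eq_lintegral_ofReal hf (.of_forall hf0), normalizeMeasure,
    lintegral_smul_measure, smul_eq_mul]
  congr 1
  rw [bridgeMeasure, lintegral_withDensity_eq_lintegral_mul_non_measurable _
    (measurable_ofReal_bridgeDensity hc) (.of_forall fun _ => ENNReal.ofReal_lt_top)]
  congr 1; ext q
  rw [Pi.mul_apply, ENNReal.ofReal_mul (hf0 q), mul_comm]

end Normalized

/-- Ballot lower bound in the extreme regime: fix `δ > 0`. There exists `ε > 0`
such that for all `N ≥ 1` and all `x, y > 0` with `xy = δN`, the random walk
bridge from `x` to `y` on `⟦0,N⟧` stays nonnegative at times `1, …, N-1` with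
probability at least `ε`. -/
theorem ballot_lower_extreme (H : ℝ → ℝ) (hH : RWAssumptions H)
    (δ : ℝ) (hδ : 0 < δ) :
    ∃ ε > 0, ∀ N : ℕ, 1 ≤ N → ∀ x y : ℝ, 0 < x → 0 < y → x * y = δ * N →
      ENNReal.ofReal ε
        ≤ probOf (bridgeMeasure H x y (N - 1))
            {q | ∀ k, 1 ≤ k → k ≤ N - 1 → 0 ≤ pathOf x y (N - 1) q k} := by
  have hc := hH.convex
  have hHexp := hH.integrable_exp
  obtain ⟨C, hC, hpair⟩ := exists_lintegral_second_difference_le hc hHexp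
  obtain ⟨ε, hε, hbound⟩ := IsExchangeableBridge.exists_lower_bound (C := 8 * C + 6) hδ
    (by positivity)
  refine ⟨min ε 1, by positivity, fun N hN x y hx hy hxy => ?_⟩
  obtain ⟨n, rfl⟩ := Nat.exists_eq_add_of_le' hN
  simp only [Nat.add_sub_cancel]
  have h0 : bridgeMeasure H x y n Set.univ ≠ 0 := bridgeMeasure_univ_ne_zero hc
  have ht : bridgeMeasure H x y n Set.univ ≠ ∞ := bridgeMeasure_univ_ne_top hc hHexp
  rcases Nat.eq_zero_or_pos n with rfl | hn
  · have e : {q | ∀ k, 1 ≤ k → k ≤ 0 → 0 ≤ pathOf x y 0 q k} = Set.univ := by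
      ext q
      simp only [Set.mem_univ, iff_true]
      intro k h1 h2
      omega
    rw [probOf, e, ENNReal.div_self h0 ht]
    exact ENNReal.ofReal_le_one.2 (min_le_right _ _)
  · have : IsProbabilityMeasure (normalizeMeasure (bridgeMeasure H x y n)) :=
      isProbabilityMeasure_normalizeMeasure h0 ht
    have hbridge := isExchangeableBridge_pathOf (u := x) (v := y) (n := n) hc hHexp
    have hL := hbridge.memLp
    have i1 : Integrable (fun q => (pathOf x y n q 1
        - (pathOf x y n q 0 + pathOf x y n q 2) / 2) ^ 2)
        (normalizeMeasure (bridgeMeasure H x y n)) := by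
      have := ((hL 0).add (hL 2)).const_mul (1 / 2)
      convert ((hL 1).sub this).integrable_sq using 3
      simp only [Pi.sub_apply, Pi.add_apply]
      ring
    have i2 : Integrable (fun q => C + 3 / 4 * ((pathOf x y n q 2 - pathOf x y n q 0) / 2) ^ 2)
        (normalizeMeasure (bridgeMeasure H x y n)) := by
      have := (((hL 2).sub (hL 0)).const_mul (1 / 2)).integrable_sq.const_mul (3 / 4)
      refine ((integrable_const C).add this).congr (.of_forall fun q => ?_)
      simp only [Pi.add_apply, Pi.sub_apply]
      ring
    have hsecond := hbridge.variance_first_le (C := C) (by omega) (by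
      rw [← ENNReal.ofReal_le_ofReal_iff (integral_nonneg fun q => by positivity),
        ofReal_integral_normalizeMeasure hc i1 (fun q => by positivity),
        ofReal_integral_normalizeMeasure hc i2 (fun q => by positivity)]
      exact mul_le_mul_of_nonneg_left (hpair x y n hn) zero_le)
    have hκ := hsecond.trans (by nlinarith [sq_nonneg ((y - x) / ((n + 1 : ℕ) : ℝ))] :
      _ ≤ (8 * C + 6) * (1 + ((y - x) / ((n + 1 : ℕ) : ℝ)) ^ 2))
    have key := hbound _ (n + 1) _ x y hbridge (by omega) hx hy hxy hκ
    rw [Nat.add_sub_cancel] at key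
    calc ENNReal.ofReal (min ε 1) ≤ ENNReal.ofReal ε :=
          ENNReal.ofReal_le_ofReal (min_le_left _ _)
      _ ≤ normalizeMeasure (bridgeMeasure H x y n)
          {q | ∀ k ∈ Finset.Icc 1 n, 0 ≤ pathOf x y n q k} :=
          ENNReal.ofReal_le_of_le_toReal key
      _ = _ := by
          rw [normalizeMeasure, Measure.smul_apply, smul_eq_mul, probOf, div_eq_mul_inv, mul_comm]
          congr 3
          ext q
          simp only [Finset.mem_Icc, and_imp]
          rfl
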